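/- For every β > 0 and every integer r ≥ 1 there exist positive reals ω_1,…,ω_r and α_1,…,α_r such that the exponential sum S_r(x) := Σ_{k=1}^r ω_k e^{−α_k x} satisfies: (i) |1/x − S_r(x)| ≤ (16/β)·e^{−π√r} for all x ∈ [β, ∞); and (ii) S_r(x) ≤ 1/x for all x ≥ (max{β,1}/8)·e^{π√r}. -/

import Mathlib

/-- Functions annihilated by the product of the operators `f ↦ f' + l f`, `l ∈ L`. -/
def EP : List ℝ → (ℝ → ℝ) → Prop
  | [], f => ∀ t, f t = 0
  | l :: L, f => Differentiable ℝ f ∧ EP L (fun t => deriv f t + l * f t)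

lemma EP.zero : ∀ L : List ℝ, EP L (fun _ => 0)
  | [] => fun _ => rfl
  | l :: L => ⟨differentiable_const _, by simpa using EP.zero L⟩

lemma EP.add : ∀ (L : List ℝ) {f g : ℝ → ℝ}, EP L f → EP L g → EP L (fun t => f t + g t)
  | [], f, g, hf, hg => fun t => by
      change f t + g t = 0
      rw [hf t, hg t, add_zero]
  | l :: L, f, g, hf, hg => by
      refine ⟨hf.1.add hg.1, ?_⟩
      have := EP.add L hf.2 hg.2
      convert this using 2 with t
      rw [deriv_fun_add (hf.1 t) (hg.1 t)]; ring

lemma EP.sum {ι : Type*} (L : List ℝ) (s : Finset ι) {f : ι → ℝ → ℝ}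
    (h : ∀ i ∈ s, EP L (f i)) : EP L (fun t => ∑ i ∈ s, f i t) := by
  classical
  induction s using Finset.induction_on with
  | empty => simpa using EP.zero L
  | insert a s ha ih =>
    simp only [Finset.sum_insert ha]
    exact EP.add L (h a (Finset.mem_insert_self _ _))
      (ih fun i hi => h i (Finset.mem_insert_of_mem hi))

lemma hasDerivAt_expform (c d x t : ℝ) :
    HasDerivAt (fun t => (c + d * t) * Real.exp (-x * t))
      ((d - x * (c + d * t)) * Real.exp (-x * t)) t := by
  have h1 : HasDerivAt (fun t : ℝ => c + d * t) d t := by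
    simpa using ((hasDerivAt_id t).const_mul d).const_add c
  have h2 : HasDerivAt (fun t : ℝ => Real.exp (-x * t)) (Real.exp (-x * t) * (-x)) t := by
    simpa using ((hasDerivAt_id t).const_mul (-x)).exp
  refine (h1.fun_mul h2).congr_deriv ?_
  ring

lemma EP.exp1 : ∀ (L : List ℝ) (c x : ℝ), x ∈ L → EP L (fun t => c * Real.exp (-x * t))
  | l :: L, c, x, h => by
      have hd : ∀ t, HasDerivAt (fun t => c * Real.exp (-x * t)) (-x * (c * Real.exp (-x * t))) t := by
        intro t
        have := hasDerivAt_expform c 0 x t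
        convert this using 1
        · simp
        · ring
      refine ⟨fun t => (hd t).differentiableAt, ?_⟩
      have e : (fun t => deriv (fun t => c * Real.exp (-x * t)) t + l * (c * Real.exp (-x * t)))
        = fun t => ((l - x) * c) * Real.exp (-x * t) := by
        funext t; rw [(hd t).deriv]; ring
      rw [e]
      by_cases hx : x = l
      · subst hx; simpa using EP.zero L
      · exact EP.exp1 L _ x (by simpa [hx] using h)

lemma EP.exp2 : ∀ (L : List ℝ) (c d x : ℝ), 2 ≤ L.count x →
    EP L (fun t => (c + d * t) * Real.exp (-x * t))
  | [], c, d, x, h => by simp at h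
  | l :: L, c, d, x, h => by
      refine ⟨fun t => (hasDerivAt_expform c d x t).differentiableAt, ?_⟩
      have e : (fun t => deriv (fun t => (c + d * t) * Real.exp (-x * t)) t
          + l * ((c + d * t) * Real.exp (-x * t)))
        = fun t => ((d + (l - x) * c) + ((l - x) * d) * t) * Real.exp (-x * t) := by
        funext t; rw [(hasDerivAt_expform c d x t).deriv]; ring
      rw [e]
      by_cases hx : l = x
      · subst hx
        have : l ∈ L := by
          rw [← List.count_pos_iff]
          rw [List.count_cons_self] at h; omega
        simpa using EP.exp1 L d l this
      · exact EP.exp2 L _ _ x (by simpa [List.count_cons, hx] using h)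

lemma rolle_finset {g : ℝ → ℝ} (hg : Differentiable ℝ g) (Z : Finset ℝ) (hZ : ∀ z ∈ Z, g z = 0) :
    ∃ Z' : Finset ℝ, (∀ z ∈ Z', deriv g z = 0) ∧ Disjoint Z' Z ∧ Z.card ≤ Z'.card + 1 ∧
      (∀ z ∈ Z', ∃ y ∈ Z, z < y) := by
  classical
  induction Z using Finset.induction_on_max with
  | empty => exact ⟨∅, by simp⟩
  | insert a Z ha ih =>
    obtain ⟨Z', h1, h2, h3, h4⟩ := ih fun z hz => hZ z (Finset.mem_insert_of_mem hz)
    have haZ : a ∉ Z := fun h => lt_irrefl _ (ha a h)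
    rcases Z.eq_empty_or_nonempty with he | hne
    · subst he
      exact ⟨∅, by simp⟩
    · set b := Z.max' hne
      have hb : b ∈ Z := Z.max'_mem hne
      have hba : b < a := ha b hb
      obtain ⟨c, hc, hc0⟩ := exists_deriv_eq_zero hba hg.continuous.continuousOn
        (by rw [hZ b (Finset.mem_insert_of_mem hb), hZ a (Finset.mem_insert_self _ _)])
      have hcZ : c ∉ Z := fun h => absurd (Z.le_max' c h) (not_le.2 hc.1)
      have hcZ' : c ∉ Z' := fun h => by
        obtain ⟨y, hy, hcy⟩ := h4 c h
        exact absurd (Z.le_max' y hy) (not_le.2 (hc.1.trans hcy))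
      have haZ' : a ∉ Z' := fun h => by
        obtain ⟨y, hy, hcy⟩ := h4 a h
        exact lt_asymm hcy (ha y hy)
      refine ⟨insert c Z', ?_, ?_, ?_, ?_⟩
      · intro z hz
        rcases Finset.mem_insert.1 hz with rfl | h
        · exact hc0
        · exact h1 z h
      · rw [Finset.disjoint_left]
        intro z hz hz2
        rcases Finset.mem_insert.1 hz with rfl | h
        · rcases Finset.mem_insert.1 hz2 with h' | h'
          · exact absurd h' hc.2.ne
          · exact hcZ h'
        · rcases Finset.mem_insert.1 hz2 with h' | h'
          · exact haZ' (h' ▸ h)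
          · exact Finset.disjoint_left.1 h2 h h'
      · rw [Finset.card_insert_of_notMem haZ, Finset.card_insert_of_notMem hcZ']; omega
      · intro z hz
        rcases Finset.mem_insert.1 hz with rfl | h
        · exact ⟨a, Finset.mem_insert_self _ _, hc.2⟩
        · obtain ⟨y, hy, hz⟩ := h4 z h
          exact ⟨y, Finset.mem_insert_of_mem hy, hz⟩

lemma hasDerivAt_mulexp {f : ℝ → ℝ} (hf : Differentiable ℝ f) (l t : ℝ) :
    HasDerivAt (fun t => f t * Real.exp (l * t)) ((deriv f t + l * f t) * Real.exp (l * t)) t := by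
  have h2 : HasDerivAt (fun t : ℝ => Real.exp (l * t)) (Real.exp (l * t) * l) t := by
    simpa using ((hasDerivAt_id t).const_mul l).exp
  refine ((hf t).hasDerivAt.fun_mul h2).congr_deriv ?_
  ring

lemma rolle_op {f : ℝ → ℝ} (hf : Differentiable ℝ f) (l : ℝ) (Z : Finset ℝ)
    (hZ : ∀ z ∈ Z, f z = 0) :
    ∃ Z' : Finset ℝ, (∀ z ∈ Z', deriv f z + l * f z = 0) ∧ Disjoint Z' Z ∧ Z.card ≤ Z'.card + 1 := by
  obtain ⟨Z', h1, h2, h3, -⟩ := rolle_finset (g := fun t => f t * Real.exp (l * t))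
    (fun t => (hasDerivAt_mulexp hf l t).differentiableAt) Z
    (fun z hz => by simp [hZ z hz])
  refine ⟨Z', fun z hz => ?_, h2, h3⟩
  have := h1 z hz
  rw [(hasDerivAt_mulexp hf l z).deriv] at this
  exact (mul_eq_zero.1 this).resolve_right (Real.exp_ne_zero _)

lemma op_zero {f : ℝ → ℝ} (hf : Differentiable ℝ f) (l : ℝ) (z : ℝ) (hz : f z = 0)
    (h : ∀ t, deriv f t + l * f t = 0) : ∀ t, f t = 0 := by
  intro t
  have hc := is_const_of_deriv_eq_zero (f := fun t => f t * Real.exp (l * t))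
    (fun t => (hasDerivAt_mulexp hf l t).differentiableAt)
    (fun t => by rw [(hasDerivAt_mulexp hf l t).deriv, h t, zero_mul]) t z
  simp only [hz, zero_mul] at hc
  exact (mul_eq_zero.1 hc).resolve_right (Real.exp_ne_zero _)

lemma EP.eq_zero : ∀ (L : List ℝ) (f : ℝ → ℝ), EP L f → ∀ Z : Finset ℝ, (∀ z ∈ Z, f z = 0) →
    L.length ≤ Z.card → ∀ t, f t = 0
  | [], f, h, _, _, _ => h
  | l :: L, f, h, Z, hZ, hc => by
      obtain ⟨Z', h1, -, h3⟩ := rolle_op h.1 l Z hZ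
      simp only [List.length_cons] at hc
      have h0 := EP.eq_zero L _ h.2 Z' h1 (by omega)
      obtain ⟨z, hz⟩ : Z.Nonempty := by rw [← Finset.card_pos]; omega
      exact op_zero h.1 l z (hZ z hz) h0

/-- zero counting with double zeros -/
lemma EP.eq_zero2 (L : List ℝ) (f : ℝ → ℝ) (h : EP L f) (Z Y : Finset ℝ) (hZ : ∀ z ∈ Z, f z = 0)
    (hYZ : Y ⊆ Z) (hY : ∀ z ∈ Y, deriv f z = 0) (hne : Z.Nonempty)
    (hc : L.length ≤ Z.card + Y.card) : ∀ t, f t = 0 := by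
  classical
  rcases L with _ | ⟨l, L⟩
  · exact h
  obtain ⟨Z', h1, h2, h3⟩ := rolle_op h.1 l Z hZ
  obtain ⟨z, hz⟩ := hne
  refine op_zero h.1 l z (hZ z hz) (EP.eq_zero L _ h.2 (Z' ∪ Y) ?_ ?_)
  · intro w hw
    rcases Finset.mem_union.1 hw with hw | hw
    · exact h1 w hw
    · rw [hY w hw, hZ w (hYZ hw)]; ring
  · have : Disjoint Z' Y := Finset.disjoint_of_subset_right hYZ h2
    rw [Finset.card_union_of_disjoint this]
    simp only [List.length_cons] at hc; omega
section AbstractMin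

variable {ι : Type*} [Fintype ι]

/-- penalised least squares functional -/
noncomputable def JF {n : ℕ} (U : OnePoint ℝ → ι → ℝ) (c : ι → ℝ) (ε : ℝ) (m : Fin n → ℝ)
    (a : Fin n → OnePoint ℝ) : ℝ :=
  (∑ i, (∑ k, m k * U (a k) i - c i) ^ 2) / 2 + ε * ∑ k, m k

lemma JF_exists_min {n : ℕ} (U : OnePoint ℝ → ι → ℝ) (hU : Continuous U) (c : ι → ℝ) (ε : ℝ)
    (hε : 0 < ε) : ∃ (m : Fin n → ℝ) (a : Fin n → OnePoint ℝ), (∀ k, 0 ≤ m k) ∧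
      ∀ (m' : Fin n → ℝ) (a' : Fin n → OnePoint ℝ), (∀ k, 0 ≤ m' k) → JF U c ε m a ≤ JF U c ε m' a' := by
  obtain ⟨C, hC0, hC⟩ : ∃ C : ℝ, 0 ≤ C ∧ (∑ i, (c i) ^ 2) / 2 ≤ ε * C := by
    have : 0 ≤ (∑ i, (c i) ^ 2) / 2 := by positivity
    exact ⟨(∑ i, (c i) ^ 2) / 2 / ε, by positivity, by field_simp; rfl⟩
  let K : Set ((Fin n → ℝ) × (Fin n → OnePoint ℝ)) := (Set.Icc 0 (fun _ => C)) ×ˢ Set.univ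
  have hK : IsCompact K := isCompact_Icc.prod isCompact_univ
  have hUi : ∀ i, Continuous fun t => U t i := fun i => (continuous_apply i).comp hU
  have hcont : Continuous fun p : (Fin n → ℝ) × (Fin n → OnePoint ℝ) => JF U c ε p.1 p.2 := by
    unfold JF
    have h1 : ∀ k i, Continuous fun p : (Fin n → ℝ) × (Fin n → OnePoint ℝ) => U (p.2 k) i :=
      fun k i => (hUi i).comp ((continuous_apply k).comp continuous_snd)
    have h2 : ∀ k, Continuous fun p : (Fin n → ℝ) × (Fin n → OnePoint ℝ) => p.1 k :=
      fun k => (continuous_apply k).comp continuous_fst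
    refine Continuous.add (Continuous.div_const ?_ _) (continuous_const.mul ?_)
    · exact continuous_finsetSum _ fun i _ => ((continuous_finsetSum _ fun k _ =>
        (h2 k).mul (h1 k i)).sub continuous_const).pow 2
    · exact continuous_finsetSum _ fun k _ => h2 k
  have h0K : ((0 : Fin n → ℝ), (fun _ => OnePoint.infty : Fin n → OnePoint ℝ)) ∈ K :=
    ⟨⟨le_refl _, fun _ => hC0⟩, trivial⟩
  obtain ⟨⟨m, a⟩, hmK, hmin⟩ := hK.exists_isMinOn ⟨_, h0K⟩ hcont.continuousOn
  have hmin' : ∀ p ∈ K, JF U c ε m a ≤ JF U c ε p.1 p.2 := isMinOn_iff.1 hmin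
  refine ⟨m, a, fun k => hmK.1.1 k, fun m' a' hm' => ?_⟩
  by_cases h : ∀ k, m' k ≤ C
  · exact hmin' (m', a') ⟨⟨fun k => hm' k, fun k => h k⟩, trivial⟩
  · push Not at h
    obtain ⟨k, hk⟩ := h
    have h1 := hmin' _ h0K
    have h2 : C ≤ ∑ k, m' k := hk.le.trans (Finset.single_le_sum (fun i _ => hm' i) (Finset.mem_univ k))
    refine h1.trans ?_
    have h3 : JF U c ε (0 : Fin n → ℝ) (fun _ => OnePoint.infty) = (∑ i, (c i) ^ 2) / 2 := by
      simp [JF]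
    have h4 : 0 ≤ (∑ i, (∑ k, m' k * U (a' k) i - c i) ^ 2) / 2 := by positivity
    have h5 := mul_le_mul_of_nonneg_left h2 hε.le
    calc _ = (∑ i, (c i) ^ 2) / 2 := h3
      _ ≤ _ := by unfold JF; linarith

lemma JF_diff {n : ℕ} (U : OnePoint ℝ → ι → ℝ) (c : ι → ℝ) (ε : ℝ) (m m' : Fin n → ℝ)
    (a a' : Fin n → OnePoint ℝ) (w : ι → ℝ) (δ : ℝ)
    (hw : ∀ i, ∑ k, m' k * U (a' k) i = ∑ k, m k * U (a k) i + w i)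
    (hδ : ∑ k, m' k = ∑ k, m k + δ) :
    JF U c ε m' a' - JF U c ε m a =
      ∑ i, (∑ k, m k * U (a k) i - c i) * w i + (∑ i, w i ^ 2) / 2 + ε * δ := by
  unfold JF
  have : ∑ i, (∑ k, m' k * U (a' k) i - c i) ^ 2 = ∑ i, (∑ k, m k * U (a k) i - c i) ^ 2
      + 2 * ∑ i, (∑ k, m k * U (a k) i - c i) * w i + ∑ i, w i ^ 2 := by
    rw [Finset.mul_sum, ← Finset.sum_add_distrib, ← Finset.sum_add_distrib]
    refine Finset.sum_congr rfl fun i _ => ?_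
    rw [hw i]; ring
  rw [this, hδ]; ring

lemma sum_upd {n : ℕ} (f : Fin n → ℝ) (g : Fin n → ℝ) (k : Fin n) (h : ∀ j, j ≠ k → f j = g j) :
    ∑ j, f j = ∑ j, g j + (f k - g k) := by
  rw [← Finset.add_sum_erase _ f (Finset.mem_univ k), ← Finset.add_sum_erase _ g (Finset.mem_univ k),
    Finset.sum_congr rfl (fun j hj => h j (Finset.ne_of_mem_erase hj))]
  ring

/-- abstract linear+quadratic positivity -/
lemma nonneg_of_quad {q e : ℝ} (h : ∀ μ : ℝ, 0 < μ → μ ≤ 1 → 0 ≤ μ * q + μ ^ 2 * e) : 0 ≤ q := by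
  by_contra hq
  push Not at hq
  have he : 0 < |e| + 1 := by positivity
  set μ := min 1 (-q / (2 * (|e| + 1))) with hμ
  have h0 : 0 < μ := lt_min one_pos (div_pos (by linarith) (by positivity))
  have h1 := h μ h0 (min_le_left _ _)
  have h2 : μ * (2 * (|e| + 1)) ≤ -q := by
    rw [← le_div_iff₀ (by positivity)]; exact min_le_right _ _
  have h3 : e ≤ |e| := le_abs_self e
  have h4 : 0 ≤ q + μ * e := by
    by_contra hh
    push Not at hh
    nlinarith
  nlinarith

theorem abs_step {n : ℕ} (U : OnePoint ℝ → ι → ℝ) (hU : Continuous U)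
    (hUinf : U OnePoint.infty = 0) (c : ι → ℝ)
    (hdiff : ∀ i, Differentiable ℝ fun t : ℝ => U (t : OnePoint ℝ) i) (ε : ℝ) (hε : 0 < ε)
    (hZ : ∀ (e : ι → ℝ) (t : Fin (n + 1) → ℝ), Function.Injective t →
      (∀ k, ∑ i, e i * U (t k : OnePoint ℝ) i + ε = 0) →
      (∀ k, deriv (fun s : ℝ => ∑ i, e i * U (s : OnePoint ℝ) i) (t k) = 0) → False) :
    ∃ (m : Fin n → ℝ) (a : Fin n → OnePoint ℝ) (e : ι → ℝ), (∀ k, 0 ≤ m k) ∧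
      (∀ i, ∑ k, m k * U (a k) i - c i = e i) ∧
      (∀ b, 0 ≤ ∑ i, e i * U b i + ε) ∧
      (∀ k, m k * (∑ i, e i * U (a k) i + ε) = 0) := by
  classical
  obtain ⟨m, a, hm, hmin⟩ := JF_exists_min (n := n + 1) U hU c ε hε
  set e : ι → ℝ := fun i => ∑ k, m k * U (a k) i - c i with he
  -- single variation
  have var : ∀ (k : Fin (n + 1)) (μ : ℝ) (b : OnePoint ℝ), 0 ≤ μ →
      0 ≤ ∑ i, e i * (μ * U b i - m k * U (a k) i) +
        (∑ i, (μ * U b i - m k * U (a k) i) ^ 2) / 2 + ε * (μ - m k) := by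
    intro k μ b hμ
    have h := hmin (Function.update m k μ) (Function.update a k b) (by
      intro j
      by_cases hj : j = k
      · subst hj; simpa using hμ
      · simpa [hj] using hm j)
    rw [← JF_diff U c ε m (Function.update m k μ) a (Function.update a k b)
      (fun i => μ * U b i - m k * U (a k) i) (μ - m k)
      (fun i => by
        rw [sum_upd _ (fun j => m j * U (a j) i) k (fun j hj => by simp [hj])]
        simp)
      (by rw [sum_upd _ m k (fun j hj => by simp [hj])]; simp)]
    linarith
  have hcs : ∀ k, 0 < m k → ∑ i, e i * U (a k) i + ε = 0 := by
    intro k hk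
    have key : ∀ δ : ℝ, -m k ≤ δ → 0 ≤ δ * (∑ i, e i * U (a k) i + ε) +
        δ ^ 2 * ((∑ i, U (a k) i ^ 2) / 2) := by
      intro δ hδ
      have h := var k (m k + δ) (a k) (by linarith)
      have e1 : ∑ i, e i * ((m k + δ) * U (a k) i - m k * U (a k) i) = δ * ∑ i, e i * U (a k) i := by
        rw [Finset.mul_sum]; exact Finset.sum_congr rfl fun i _ => by ring
      have e2 : ∑ i, ((m k + δ) * U (a k) i - m k * U (a k) i) ^ 2 = δ ^ 2 * ∑ i, U (a k) i ^ 2 := by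
        rw [Finset.mul_sum]; exact Finset.sum_congr rfl fun i _ => by ring
      rw [e1, e2] at h
      linarith
    refine le_antisymm ?_ ?_
    · have : 0 ≤ m k * -(∑ i, e i * U (a k) i + ε) := by
        apply nonneg_of_quad (e := m k ^ 2 * ((∑ i, U (a k) i ^ 2) / 2))
        intro μ hμ hμ1
        have := key (-(μ * m k)) (by nlinarith)
        linarith
      nlinarith
    · exact nonneg_of_quad fun μ hμ _ => key μ (by linarith)
  have hcs' : ∀ k, m k * (∑ i, e i * U (a k) i + ε) = 0 := by
    intro k
    rcases (hm k).eq_or_lt with h | h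
    · rw [← h, zero_mul]
    · rw [hcs k h, mul_zero]
  -- there is a free slot
  have hfree : ∃ (m' : Fin (n + 1) → ℝ) (l : Fin (n + 1)), (∀ k, 0 ≤ m' k) ∧ m' l = 0 ∧
      (∀ i, ∑ k, m' k * U (a k) i = ∑ k, m k * U (a k) i) ∧ (∑ k, m' k = ∑ k, m k) ∧
      (∀ k, m' k * (∑ i, e i * U (a k) i + ε) = 0) := by
    by_cases h0 : ∃ l, m l = 0
    · obtain ⟨l, hl⟩ := h0
      exact ⟨m, l, hm, hl, fun _ => rfl, rfl, hcs'⟩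
    push Not at h0
    have hpos : ∀ k, 0 < m k := fun k => lt_of_le_of_ne (hm k) (h0 k).symm
    by_cases hinj : Function.Injective a
    · exfalso
      have hfin : ∀ k, ∃ t : ℝ, (t : OnePoint ℝ) = a k := by
        intro k
        rcases OnePoint.ne_infty_iff_exists.1 (show a k ≠ OnePoint.infty by
          intro h
          have := hcs k (hpos k)
          rw [h, hUinf] at this
          simp at this
          exact hε.ne' this) with ⟨t, ht⟩
        exact ⟨t, ht⟩
      choose t ht using hfin
      refine hZ e t ?_ ?_ ?_
      · intro i j hij
        apply hinj
        rw [← ht i, ← ht j, hij]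
      · intro k; rw [ht k]; exact hcs k (hpos k)
      · intro k
        have hmk := hpos k
        set f : ℝ → ℝ := fun s => ∑ i, e i * U (s : OnePoint ℝ) i with hf
        have hfd : Differentiable ℝ f := by
          have : f = fun s : ℝ => ∑ i, e i * U (s : OnePoint ℝ) i := rfl
          rw [this]
          exact Differentiable.fun_sum fun i _ => (hdiff i).const_mul _
        set g : ℝ → ℝ := fun s => (∑ i, (U (s : OnePoint ℝ) i - U (a k) i) ^ 2) with hg
        have hgd : HasDerivAt g 0 (t k) := by
          have h1 : ∀ i ∈ Finset.univ, HasDerivAt (fun s : ℝ => (U (s : OnePoint ℝ) i - U (a k) i) ^ 2) 0 (t k) := by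
            intro i _
            have := (((hdiff i) (t k)).hasDerivAt.sub_const (U (a k) i)).fun_pow 2
            refine this.congr_deriv ?_
            rw [ht k]; simp
          have := HasDerivAt.fun_sum h1
          simpa using this
        have hF : HasDerivAt (fun s => m k * f s + m k ^ 2 * (g s / 2)) (m k * deriv f (t k) + m k ^ 2 * (0 / 2)) (t k) :=
          ((hfd (t k)).hasDerivAt.const_mul _).add ((hgd.div_const 2).const_mul _)
        have hloc : IsLocalMin (fun s => m k * f s + m k ^ 2 * (g s / 2)) (t k) := by
          refine Filter.Eventually.of_forall fun s => ?_
          have h := var k (m k) (s : OnePoint ℝ) (hm k)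
          have e1 : ∑ i, e i * (m k * U (s : OnePoint ℝ) i - m k * U (a k) i) = m k * f s - m k * f (t k) := by
            simp only [hf, ht k, Finset.mul_sum, ← Finset.sum_sub_distrib]
            exact Finset.sum_congr rfl fun i _ => by ring
          have e2 : ∑ i, (m k * U (s : OnePoint ℝ) i - m k * U (a k) i) ^ 2 = m k ^ 2 * g s := by
            simp only [hg, Finset.mul_sum]
            exact Finset.sum_congr rfl fun i _ => by ring
          have e3 : g (t k) = 0 := by simp [hg, ht k]
          rw [e1, e2] at h
          simp only [e3]
          linarith
        have h0 := hloc.hasDerivAt_eq_zero hF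
        simp at h0
        exact h0.resolve_left hmk.ne'
    · simp only [Function.Injective] at hinj
      push Not at hinj
      obtain ⟨k, l, hkl, hne⟩ := hinj
      refine ⟨Function.update (Function.update m k (m k + m l)) l 0, l, ?_, by simp, ?_, ?_, ?_⟩
      · intro j
        by_cases hj : j = l
        · subst hj; simp
        · by_cases hjk : j = k
          · subst hjk; simpa [hj] using add_nonneg (hm j) (hm l)
          · simpa [hj, hjk] using hm j
      · intro i
        rw [sum_upd _ (fun j => Function.update m k (m k + m l) j * U (a j) i) l (fun j hj => by simp [hj]),
          sum_upd _ (fun j => m j * U (a j) i) k (fun j hj => by simp [hj])]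
        simp [hne.symm, hkl]
        ring
      · rw [sum_upd _ (Function.update m k (m k + m l)) l (fun j hj => by simp [hj]),
          sum_upd _ m k (fun j hj => by simp [hj])]
        simp [hne.symm]
      · intro j
        by_cases hj : j = l
        · subst hj; simp
        · by_cases hjk : j = k
          · subst hjk; rw [hcs j (hpos j), mul_zero]
          · simp only [ne_eq, hj, not_false_eq_true, Function.update_of_ne, hjk]
            exact hcs' j
  obtain ⟨m', l, hm', hl, hV, hS, hC⟩ := hfree
  refine ⟨fun k => m' (l.succAbove k), fun k => a (l.succAbove k), e, fun k => hm' _, ?_, ?_, fun k => hC _⟩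
  · intro i
    have := hV i
    rw [Fin.sum_univ_succAbove _ l, hl, zero_mul, zero_add] at this
    rw [this]
  · intro b
    refine nonneg_of_quad (e := (∑ i, U b i ^ 2) / 2) fun μ hμ _ => ?_
    have h := hmin (Function.update m' l μ) (Function.update a l b) (by
      intro j
      by_cases hj : j = l
      · subst hj; simpa using hμ.le
      · simpa [hj] using hm' j)
    have hd := JF_diff U c ε m (Function.update m' l μ) a (Function.update a l b)
      (fun i => μ * U b i) μ
      (fun i => by
        rw [← hV i, sum_upd _ (fun j => m' j * U (a j) i) l (fun j hj => by simp [hj])]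
        simp [hl])
      (by rw [← hS, sum_upd _ m' l (fun j hj => by simp [hj])]; simp [hl])
    have e1 : ∑ i, e i * (μ * U b i) = μ * ∑ i, e i * U b i := by
      rw [Finset.mul_sum]; exact Finset.sum_congr rfl fun i _ => by ring
    have e2 : ∑ i, (μ * U b i) ^ 2 = μ ^ 2 * ∑ i, U b i ^ 2 := by
      rw [Finset.mul_sum]; exact Finset.sum_congr rfl fun i _ => by ring
    have hd' : _ = ∑ i, e i * (μ * U b i) + (∑ i, (μ * U b i) ^ 2) / 2 + ε * μ := hd
    rw [e1, e2] at hd'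
    linarith

theorem abs_interp {n : ℕ} (U : OnePoint ℝ → ι → ℝ) (hU : Continuous U)
    (hUinf : U OnePoint.infty = 0) (c : ι → ℝ) (C : ℝ) 
    (hdiff : ∀ i, Differentiable ℝ fun t : ℝ => U (t : OnePoint ℝ) i)
    (hInt : ∀ ε : ℝ, 0 < ε → ∀ e : ι → ℝ, (∀ t : ℝ, 0 ≤ ∑ i, e i * U (t : OnePoint ℝ) i + ε) →
      0 ≤ ∑ i, e i * c i + ε * C)
    (hZ : ∀ ε : ℝ, 0 < ε → ∀ (e : ι → ℝ) (t : Fin (n + 1) → ℝ), Function.Injective t →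
      (∀ k, ∑ i, e i * U (t k : OnePoint ℝ) i + ε = 0) →
      (∀ k, deriv (fun s : ℝ => ∑ i, e i * U (s : OnePoint ℝ) i) (t k) = 0) → False) :
    ∃ (m : Fin n → ℝ) (a : Fin n → ℝ), (∀ k, 0 ≤ m k) ∧
      (∀ i, ∑ k, m k * U (a k : OnePoint ℝ) i = c i) := by
  classical
  have hC0 : 0 ≤ C := by
    have := hInt 1 one_pos 0 (by intro t; simp)
    simpa using this
  let K : Set ((Fin n → ℝ) × (Fin n → OnePoint ℝ)) := (Set.Icc 0 (fun _ => C)) ×ˢ Set.univ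
  have hK : IsCompact K := isCompact_Icc.prod isCompact_univ
  have hUi : ∀ i, Continuous fun t => U t i := fun i => (continuous_apply i).comp hU
  have hcont : Continuous fun p : (Fin n → ℝ) × (Fin n → OnePoint ℝ) =>
      ∑ i, (∑ k, p.1 k * U (p.2 k) i - c i) ^ 2 := by
    have h1 : ∀ k i, Continuous fun p : (Fin n → ℝ) × (Fin n → OnePoint ℝ) => U (p.2 k) i :=
      fun k i => (hUi i).comp ((continuous_apply k).comp continuous_snd)
    have h2 : ∀ k, Continuous fun p : (Fin n → ℝ) × (Fin n → OnePoint ℝ) => p.1 k :=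
      fun k => (continuous_apply k).comp continuous_fst
    exact continuous_finsetSum _ fun i _ => ((continuous_finsetSum _ fun k _ =>
        (h2 k).mul (h1 k i)).sub continuous_const).pow 2
  have h0K : ((0 : Fin n → ℝ), (fun _ => OnePoint.infty : Fin n → OnePoint ℝ)) ∈ K :=
    ⟨⟨le_refl _, fun _ => hC0⟩, trivial⟩
  obtain ⟨⟨m, a⟩, hmK, hmin⟩ := hK.exists_isMinOn ⟨_, h0K⟩ hcont.continuousOn
  have hle : ∀ ε : ℝ, 0 < ε → ∑ i, (∑ k, m k * U (a k) i - c i) ^ 2 ≤ ε * C := by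
    intro ε hε
    obtain ⟨m', a', e, hm', hres, hQ, hcs⟩ := abs_step U hU hUinf c hdiff ε hε (hZ ε hε)
    have h1 := hInt ε hε e (fun t => hQ t)
    have h2 : ∑ i, e i * (∑ k, m' k * U (a' k) i) + ε * ∑ k, m' k = 0 := by
      have : ∑ k, m' k * (∑ i, e i * U (a' k) i + ε) = 0 := Finset.sum_eq_zero fun k _ => hcs k
      rw [← this]
      simp only [mul_add, Finset.sum_add_distrib, Finset.mul_sum]
      rw [Finset.sum_comm]
      congr 1
      · exact Finset.sum_congr rfl fun k _ => Finset.sum_congr rfl fun i _ => by ring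
      · exact Finset.sum_congr rfl fun k _ => by ring
    have h3 : ∑ i, e i ^ 2 = ∑ i, e i * (∑ k, m' k * U (a' k) i) - ∑ i, e i * c i := by
      rw [← Finset.sum_sub_distrib]
      refine Finset.sum_congr rfl fun i _ => ?_
      rw [← mul_sub, hres i]; ring
    have h4 : 0 ≤ ∑ i, e i ^ 2 := by positivity
    have h5 : ∑ k, m' k ≤ C := by
      have : ε * ∑ k, m' k ≤ ε * C := by linarith
      exact le_of_mul_le_mul_left this hε
    have h6 : 0 ≤ ∑ k, m' k := Finset.sum_nonneg fun k _ => hm' k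
    have h7 : ∑ i, (∑ k, m k * U (a k) i - c i) ^ 2 ≤ _ :=
      hmin (show (m', a') ∈ K from ⟨⟨fun k => hm' k, fun k =>
        (Finset.single_le_sum (fun i _ => hm' i) (Finset.mem_univ k)).trans h5⟩, trivial⟩)
    refine h7.trans ?_
    simp only [hres]
    have := mul_nonneg hε.le h6
    linarith
  have hz : ∑ i, (∑ k, m k * U (a k) i - c i) ^ 2 ≤ 0 := by
    refine le_of_forall_pos_le_add fun δ hδ => ?_
    have := hle (δ / (C + 1)) (by positivity)
    refine this.trans ?_
    rw [zero_add, div_mul_eq_mul_div, div_le_iff₀ (by positivity)]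
    nlinarith
  have hz' : ∀ i, ∑ k, m k * U (a k) i - c i = 0 := by
    intro i
    have h := (Finset.sum_eq_zero_iff_of_nonneg (fun i _ => sq_nonneg _)).1
      (le_antisymm hz (Finset.sum_nonneg fun i _ => sq_nonneg _)) i (Finset.mem_univ i)
    exact pow_eq_zero_iff two_ne_zero |>.1 h
  -- replace points at infinity
  have hrep : ∀ k, ∃ (μ t : ℝ), 0 ≤ μ ∧ ∀ i, μ * U (t : OnePoint ℝ) i = m k * U (a k) i := by
    intro k
    by_cases h : a k = OnePoint.infty
    · exact ⟨0, 0, le_refl _, fun i => by rw [h, hUinf]; simp⟩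
    · obtain ⟨t, ht⟩ := OnePoint.ne_infty_iff_exists.1 h
      exact ⟨m k, t, hmK.1.1 k, fun i => by rw [ht]⟩
  choose μ t hμ ht using hrep
  refine ⟨μ, t, hμ, fun i => ?_⟩
  rw [← sub_eq_zero, ← hz' i]
  congr 1
  exact Finset.sum_congr rfl fun k _ => ht k i

end AbstractMin
lemma tend_expform (c d : ℝ) {x : ℝ} (hx : 0 < x) :
    Filter.Tendsto (fun t : ℝ => (c + d * t) * Real.exp (-x * t)) Filter.atTop (nhds 0) := by
  have h0 : Filter.Tendsto (fun t : ℝ => x * t) Filter.atTop Filter.atTop :=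
    Filter.tendsto_id.const_mul_atTop hx
  have h1 := (Real.tendsto_pow_mul_exp_neg_atTop_nhds_zero 0).comp h0
  have h2 := (Real.tendsto_pow_mul_exp_neg_atTop_nhds_zero 1).comp h0
  have h3 := (h1.const_mul c).add (h2.const_mul (d / x))
  simp only [mul_zero, add_zero] at h3
  refine h3.congr fun t => ?_
  simp only [Function.comp, pow_zero, pow_one, neg_mul]
  field_simp

theorem interp_exists {r : ℕ} (x : Fin r → ℝ) (hpos : ∀ i, 0 < x i) :
    ∃ ω a : Fin r → ℝ, (∀ k, 0 ≤ ω k) ∧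
      (∀ i, ∑ k, ω k * Real.exp (-(a k) * x i) = 1 / x i) ∧
      (∀ i, ∑ k, ω k * a k * Real.exp (-(a k) * x i) = 1 / (x i) ^ 2) := by
  classical
  have hsl : ∀ (y : Fin r → ℝ), (∀ i, 0 < y i) → ∀ i, y i < ∑ i, y i + 1 := fun y hy i => by
    have := Finset.single_le_sum (f := y) (fun i _ => (hy i).le) (Finset.mem_univ i)
    linarith
  obtain ⟨x1, hx1, hx1l⟩ : ∃ x1 : ℝ, 0 < x1 ∧ ∀ i, x i < x1 :=
    ⟨∑ i, x i + 1, by have := Finset.sum_nonneg (fun i (_ : i ∈ Finset.univ) => (hpos i).le); linarith,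
      hsl x hpos⟩
  obtain ⟨x0, hx0, hx0l⟩ : ∃ x0 : ℝ, 0 < x0 ∧ ∀ i, x0 < x i := by
    have hp : ∀ i, 0 < (x i)⁻¹ := fun i => inv_pos.2 (hpos i)
    have h0 := Finset.sum_nonneg (fun i (_ : i ∈ Finset.univ) => (hp i).le)
    refine ⟨(∑ i, (x i)⁻¹ + 1)⁻¹, by positivity, fun i => ?_⟩
    rw [inv_lt_comm₀ (by positivity) (hpos i)]
    exact hsl (fun i => (x i)⁻¹) hp i
  set φ : ℝ → ℝ := fun t => Real.exp (-x0 * t) + Real.exp (-x1 * t) with hφ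
  have hφpos : ∀ t, 0 < φ t := fun t => by positivity
  have hφd : Differentiable ℝ φ := by
    rw [hφ]; fun_prop
  let y : Fin r ⊕ Fin r → ℝ := Sum.elim x x
  let cc : Fin r ⊕ Fin r → ℝ := Sum.elim (fun _ => 1) (fun _ => 0)
  let dd : Fin r ⊕ Fin r → ℝ := Sum.elim (fun _ => 0) (fun _ => 1)
  have hy : ∀ j, x0 < y j ∧ y j < x1 := by
    rintro (i | i) <;> exact ⟨hx0l i, hx1l i⟩
  have hy0 : ∀ j, 0 < y j := fun j => hx0.trans (hy j).1
  let V : Fin r ⊕ Fin r → ℝ → ℝ := fun j t => (cc j + dd j * t) * Real.exp (-y j * t) / φ t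
  have hVd : ∀ j, Differentiable ℝ (V j) := fun j t =>
    ((hasDerivAt_expform (cc j) (dd j) (y j) t).differentiableAt).div (hφd t) (hφpos t).ne'
  have hVt : ∀ j, Filter.Tendsto (V j) (Filter.cocompact ℝ) (nhds 0) := by
    intro j
    have hb : 0 < min (y j - x0) (x1 - y j) := lt_min (by linarith [(hy j).1]) (by linarith [(hy j).2])
    set b := min (y j - x0) (x1 - y j) with hbd
    have h1 := (tend_expform |cc j| |dd j| hb).comp (tendsto_norm_cocompact_atTop (E := ℝ))
    refine squeeze_zero_norm (fun t => ?_) h1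
    have e1 : ‖V j t‖ = |cc j + dd j * t| * (Real.exp (-y j * t) / φ t) := by
      simp only [V, norm_div, norm_mul, Real.norm_eq_abs, abs_of_pos (hφpos t), Real.abs_exp]
      ring
    rw [e1]
    simp only [Function.comp, Real.norm_eq_abs]
    refine mul_le_mul ?_ ?_ (div_nonneg (Real.exp_nonneg _) (hφpos t).le) (by positivity)
    · exact (abs_add_le _ _).trans (by rw [abs_mul])
    · rw [div_le_iff₀ (hφpos t), hφ]
      simp only [mul_add, ← Real.exp_add]
      rcases le_total 0 t with h | h
      · have : Real.exp (-y j * t) ≤ Real.exp (-b * |t| + -x0 * t) := by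
          rw [Real.exp_le_exp, abs_of_nonneg h]
          have := mul_le_mul_of_nonneg_right (min_le_left (y j - x0) (x1 - y j)) h
          linarith
        linarith [Real.exp_pos (-b * |t| + -x1 * t)]
      · have : Real.exp (-y j * t) ≤ Real.exp (-b * |t| + -x1 * t) := by
          rw [Real.exp_le_exp, abs_of_nonpos h]
          have := mul_le_mul_of_nonneg_right (min_le_right (y j - x0) (x1 - y j)) (neg_nonneg.2 h)
          linarith
        linarith [Real.exp_pos (-b * |t| + -x0 * t)]
  let U : OnePoint ℝ → (Fin r ⊕ Fin r) → ℝ := fun t j => t.elim 0 (V j)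
  have hUV : ∀ (t : ℝ) j, U (t : OnePoint ℝ) j = V j t := fun t j => rfl
  have hU : Continuous U := by
    refine continuous_pi fun j => ?_
    rw [OnePoint.continuous_iff, Filter.coclosedCompact_eq_cocompact]
    exact ⟨hVt j, (hVd j).continuous⟩
  have hUinf : U OnePoint.infty = 0 := rfl
  have hsum : ∀ (e : Fin r ⊕ Fin r → ℝ) (ε t : ℝ), (∑ j, e j * V j t + ε) * φ t =
      ∑ j, e j * ((cc j + dd j * t) * Real.exp (-y j * t)) + ε * φ t := by
    intro e ε t
    rw [add_mul, Finset.sum_mul]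
    congr 1
    refine Finset.sum_congr rfl fun j _ => ?_
    have := (hφpos t).ne'
    simp only [V]
    field_simp
  have hex : ∃ m a : Fin r → ℝ, (∀ k, 0 ≤ m k) ∧
      (∀ j, ∑ k, m k * U (a k : OnePoint ℝ) j = cc j / y j + dd j / (y j) ^ 2) := by
    refine abs_interp (n := r) U hU hUinf (fun j => cc j / y j + dd j / (y j) ^ 2)
      (1 / x0 + 1 / x1) (fun j => hVd j) ?_ ?_
    · -- integration
      intro ε hε e hQ
      let A : ℝ → ℝ := fun t => ∑ j, e j * (((-cc j / y j - dd j / (y j) ^ 2) + (-dd j / y j) * t) * Real.exp (-y j * t))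
        + ε * (((-1 / x0) + 0 * t) * Real.exp (-x0 * t) + ((-1 / x1) + 0 * t) * Real.exp (-x1 * t))
      have hA : ∀ t, HasDerivAt A ((∑ j, e j * V j t + ε) * φ t) t := by
        intro t
        rw [hsum]
        refine HasDerivAt.add (HasDerivAt.fun_sum fun j _ => ?_) ?_
        · refine ((hasDerivAt_expform _ _ _ t).const_mul (e j)).congr_deriv ?_
          have := (hy0 j).ne'
          field_simp
          ring
        · refine (((hasDerivAt_expform _ _ _ t).add (hasDerivAt_expform _ _ _ t)).const_mul ε).congr_deriv ?_
          rw [hφ]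
          field_simp
          ring
      have hmono : Monotone A := monotone_of_hasDerivAt_nonneg hA fun t =>
        mul_nonneg (hQ t) (hφpos t).le
      have htend : Filter.Tendsto A Filter.atTop (nhds (∑ j, e j * 0 + ε * (0 + 0))) := by
        refine Filter.Tendsto.add (tendsto_finsetSum _ fun j _ => ?_) ?_
        · exact (tend_expform _ _ (hy0 j)).const_mul _
        · exact ((tend_expform _ _ hx0).add (tend_expform _ _ hx1)).const_mul _
      have h := hmono.ge_of_tendsto htend 0
      simp only [A, mul_zero, add_zero, Real.exp_zero, mul_one, Finset.sum_const_zero] at h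
      have e1 : ∑ j, e j * (cc j / y j + dd j / (y j) ^ 2) = - ∑ j, e j * (-cc j / y j - dd j / (y j) ^ 2) := by
        rw [← Finset.sum_neg_distrib]
        exact Finset.sum_congr rfl fun j _ => by ring
      rw [e1]
      have e2 : ε * (-1 / x0 + -1 / x1) = - (ε * (1 / x0 + 1 / x1)) := by ring
      linarith
    · -- zeros
      intro ε hε e t ht h0 h1
      let P : ℝ → ℝ := fun t => (∑ j, e j * V j t + ε) * φ t
      have hP : EP (x0 :: x1 :: (List.ofFn x ++ List.ofFn x)) P := by
        have e1 : P = fun t => (∑ j, (e j * cc j + e j * dd j * t) * Real.exp (-y j * t)) +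
            (ε * Real.exp (-x0 * t) + ε * Real.exp (-x1 * t)) := by
          funext t
          simp only [P]
          rw [hsum, hφ, mul_add]
          congr 1
          exact Finset.sum_congr rfl fun j _ => by ring
        rw [e1]
        refine EP.add _ (EP.sum _ _ fun j _ => EP.exp2 _ _ _ _ ?_) (EP.add _ (EP.exp1 _ _ _ (by simp))
          (EP.exp1 _ _ _ (by simp)))
        have hmem : y j ∈ List.ofFn x := by
          rcases j with i | i <;> simp [y]
        have h1 : 0 < (List.ofFn x).count (y j) := List.count_pos_iff.2 hmem
        have h2 := List.count_le_count_cons (a := y j) (b := x1) (l := List.ofFn x ++ List.ofFn x)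
        have h3 := List.count_le_count_cons (a := y j) (b := x0) (l := x1 :: (List.ofFn x ++ List.ofFn x))
        rw [List.count_append] at h2
        omega
      have hz := EP.eq_zero2 _ P hP (Finset.univ.image t) (Finset.univ.image t) (by
          intro z hz
          obtain ⟨k, -, rfl⟩ := Finset.mem_image.1 hz
          have := h0 k
          simp only [hUV] at this
          simp only [P, this, zero_mul]) (Finset.Subset.refl _) (by
          intro z hz
          obtain ⟨k, -, rfl⟩ := Finset.mem_image.1 hz
          have h0k := h0 k
          have h1k := h1 k
          simp only [hUV] at h0k h1k
          have hd : HasDerivAt (fun s => ∑ j, e j * V j s + ε) 0 (t k) := by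
            have : DifferentiableAt ℝ (fun s => ∑ j, e j * V j s) (t k) :=
              DifferentiableAt.fun_sum fun j _ => ((hVd j) (t k)).const_mul _
            have := this.hasDerivAt
            rw [h1k] at this
            exact this.add_const ε
          have := (hd.fun_mul (hφd (t k)).hasDerivAt).deriv
          simp only [P]
          rw [this, h0k]; ring) ⟨t 0, by simp⟩ (by
          rw [Finset.card_image_of_injective _ ht]
          simp; omega)
      have hQ0 : ∀ s, ∑ j, e j * V j s + ε = 0 := fun s =>
        (mul_eq_zero.1 (hz s)).resolve_right (hφpos s).ne'
      have hlim : Filter.Tendsto (fun s => ∑ j, e j * V j s + ε) Filter.atTop (nhds (∑ j, e j * 0 + ε)) :=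
        (tendsto_finsetSum _ fun j _ => ((hVt j).mono_left atTop_le_cocompact).const_mul _).add_const _
      simp only [hQ0] at hlim
      have := tendsto_nhds_unique hlim tendsto_const_nhds
      simp at this
      exact hε.ne' this
  obtain ⟨m, a, hm, hma⟩ := hex
  refine ⟨fun k => m k / φ (a k), a, fun k => div_nonneg (hm k) (hφpos _).le, fun i => ?_, fun i => ?_⟩
  · have := hma (Sum.inl i)
    simp only [hUV, V, cc, dd, y, Sum.elim_inl] at this
    simp only [zero_div, add_zero] at this
    rw [← this]
    refine Finset.sum_congr rfl fun k _ => ?_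
    have e : -(a k) * x i = - x i * a k := by ring
    rw [e]; ring
  · have := hma (Sum.inr i)
    simp only [hUV, V, cc, dd, y, Sum.elim_inr] at this
    simp only [zero_div, zero_add] at this
    rw [← this]
    refine Finset.sum_congr rfl fun k _ => ?_
    have e : -(a k) * x i = - x i * a k := by ring
    rw [e]; ring
lemma nn_of_double {F : ℝ → ℝ} (hF : Differentiable ℝ F) (h0 : 0 < F 0) (Z : Finset ℝ)
    (hZ : ∀ z ∈ Z, deriv F z = 0) (hall : ∀ z, F z = 0 → z ∈ Z)
    (h2 : ∀ z ∈ Z, F z = 0 → deriv (deriv F) z ≠ 0) {t : ℝ} (ht : 0 < t) : 0 ≤ F t := by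
  by_contra hneg
  push Not at hneg
  set A : Set ℝ := {s | 0 ≤ s ∧ F s < 0} with hA
  have hAne : A.Nonempty := ⟨t, ht.le, hneg⟩
  have hAb : BddBelow A := ⟨0, fun s hs => hs.1⟩
  set c := sInf A with hc
  have hc0 : 0 ≤ c := le_csInf hAne fun s hs => hs.1
  have hleft : ∀ s, 0 ≤ s → s < c → 0 ≤ F s := by
    intro s hs hsc
    by_contra h
    push Not at h
    exact absurd (csInf_le hAb ⟨hs, h⟩) (not_le.2 hsc)
  have hcl : c ∈ closure A := csInf_mem_closure hAne hAb
  have hle : F c ≤ 0 := by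
    have : closure A ⊆ {s | F s ≤ 0} :=
      closure_minimal (fun s hs => hs.2.le) (isClosed_le hF.continuous continuous_const)
    exact this hcl
  have hcpos : 0 < c := by
    rcases hc0.eq_or_lt with h | h
    · rw [← h] at hle; linarith
    · exact h
  have hge : 0 ≤ F c := by
    have h1 : Filter.Tendsto F (nhdsWithin c (Set.Iio c)) (nhds (F c)) :=
      (hF c).continuousAt.continuousWithinAt
    refine ge_of_tendsto h1 ?_
    filter_upwards [Ioo_mem_nhdsLT hcpos] with s hs
    exact hleft s hs.1.le hs.2
  have hFc : F c = 0 := le_antisymm hle hge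
  have hcZ := hall c hFc
  rcases lt_or_gt_of_ne (h2 c hcZ hFc) with h | h
  · have hm := isLocalMax_of_deriv_deriv_neg h (hZ c hcZ) (hF c).continuousAt
    have hm' : ∀ᶠ s in nhdsWithin c (Set.Iio c), F s ≤ F c := hm.filter_mono nhdsWithin_le_nhds
    have hz : ∀ᶠ s in nhdsWithin c (Set.Iio c), s ∈ Z := by
      filter_upwards [hm', Ioo_mem_nhdsLT hcpos] with s hs1 hs2
      exact hall s (le_antisymm (hs1.trans hle) (hleft s hs2.1.le hs2.2))
    have hfin : (Z : Set ℝ) ∈ nhdsWithin c (Set.Iio c) := hz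
    obtain ⟨l, hl, hl2⟩ := (mem_nhdsLT_iff_exists_Ioo_subset).1 hfin
    exact (Set.Ioo_infinite hl) (Z.finite_toSet.subset hl2)
  · have hm := isLocalMin_of_deriv_deriv_pos h (hZ c hcZ) (hF c).continuousAt
    obtain ⟨s, hs1, hs2⟩ := (mem_closure_iff_frequently.1 hcl).and_eventually hm |>.exists
    linarith [hs1.2]

theorem interp_pos {r : ℕ} (hr : 1 ≤ r) (x : Fin r → ℝ) (hinj : Function.Injective x)
    (hpos : ∀ i, 0 < x i) :
    ∃ ω a : Fin r → ℝ, (∀ k, 0 < ω k) ∧ (∀ k, 0 < a k) ∧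
      (∀ i, ∑ k, ω k * Real.exp (-(a k) * x i) = 1 / x i) ∧
      (∀ i, ∑ k, ω k * a k * Real.exp (-(a k) * x i) = 1 / (x i) ^ 2) ∧
      (∀ t, 0 < t → ∑ k, ω k * Real.exp (-(a k) * t) ≤ 1 / t) := by
  classical
  obtain ⟨ω, a, hω, h1, h2⟩ := interp_exists x hpos
  let F : ℝ → ℝ := fun t => 1 - t * ∑ k, ω k * Real.exp (-(a k) * t)
  have hFd : ∀ t, HasDerivAt F (-(∑ k, ω k * Real.exp (-(a k) * t)) +
      t * ∑ k, ω k * a k * Real.exp (-(a k) * t)) t := by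
    intro t
    have hs : HasDerivAt (fun t => ∑ k, ω k * Real.exp (-(a k) * t))
        (∑ k, -(ω k * a k * Real.exp (-(a k) * t))) t := by
      refine HasDerivAt.fun_sum fun k _ => ?_
      have := hasDerivAt_expform (ω k) 0 (a k) t
      simp only [zero_mul, add_zero, zero_sub] at this
      exact this.congr_deriv (by ring)
    refine (((hasDerivAt_id t).fun_mul hs).const_sub 1).congr_deriv ?_
    simp only [Finset.sum_neg_distrib, id]
    ring
  have hF : Differentiable ℝ F := fun t => (hFd t).differentiableAt
  have hF0 : F 0 = 1 := by simp [F]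
  set X : Finset ℝ := Finset.univ.image x with hX
  have hXc : X.card = r := by rw [hX, Finset.card_image_of_injective _ hinj]; simp
  have hXne : X.Nonempty := by rw [← Finset.card_pos]; omega
  have hXz : ∀ z ∈ X, F z = 0 := by
    intro z hz
    obtain ⟨i, -, rfl⟩ := Finset.mem_image.1 hz
    simp only [F, h1 i]
    have := (hpos i).ne'
    field_simp
    ring
  have hXd : ∀ z ∈ X, deriv F z = 0 := by
    intro z hz
    obtain ⟨i, -, rfl⟩ := Finset.mem_image.1 hz
    rw [(hFd _).deriv, h1 i, h2 i]
    have := (hpos i).ne'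
    field_simp
    ring
  -- F in an exponential space
  have hEP : ∀ T : Finset (Fin r), (∀ k, k ∉ T → ω k = 0) →
      EP (0 :: (T.toList.map a ++ T.toList.map a)) F := by
    intro T hT
    have e : F = fun t => 1 * Real.exp (-0 * t) + ∑ k ∈ T, (0 + -ω k * t) * Real.exp (-(a k) * t) := by
      funext t
      simp only [F]
      rw [← Finset.sum_subset (Finset.subset_univ T) (fun k _ hk => by rw [hT k hk, zero_mul]),
        Finset.mul_sum, sub_eq_add_neg, ← Finset.sum_neg_distrib]
      congr 1
      · simp
      · exact Finset.sum_congr rfl fun k _ => by ring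
    rw [e]
    refine EP.add _ (EP.exp1 _ _ _ (by simp)) (EP.sum _ _ fun k hk => EP.exp2 _ _ _ _ ?_)
    have hmem : a k ∈ T.toList.map a := List.mem_map_of_mem (by simpa using hk)
    have h1 : 0 < (T.toList.map a).count (a k) := List.count_pos_iff.2 hmem
    have h2 := List.count_le_count_cons (a := a k) (b := 0) (l := T.toList.map a ++ T.toList.map a)
    rw [List.count_append] at h2
    omega
  have hωpos : ∀ k, 0 < ω k := by
    intro k
    refine lt_of_le_of_ne (hω k) fun h => ?_
    have hh := EP.eq_zero2 _ F (hEP (Finset.univ.erase k) (by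
      intro j hj
      have : j = k := by simpa using hj
      rw [this, ← h])) X X hXz (Finset.Subset.refl _) hXd hXne (by
        rw [hXc]
        simp [Finset.card_erase_of_mem]
        omega) 0
    rw [hF0] at hh
    exact one_ne_zero hh
  have hE := hEP Finset.univ (fun k hk => absurd (Finset.mem_univ k) hk)
  have hall : ∀ z, F z = 0 → z ∈ X := by
    intro z hz
    by_contra hzX
    have hh := EP.eq_zero2 _ F hE (insert z X) X (by
      intro w hw
      rcases Finset.mem_insert.1 hw with rfl | hw
      · exact hz
      · exact hXz w hw) (Finset.subset_insert _ _) hXd ⟨z, by simp⟩ (by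
        rw [Finset.card_insert_of_notMem hzX, hXc]
        simp) 0
    rw [hF0] at hh
    exact one_ne_zero hh
  have hdd : ∀ z ∈ X, F z = 0 → deriv (deriv F) z ≠ 0 := by
    intro z hz _ hzz
    obtain ⟨Z', hZ1, hZ2, hZ3⟩ := rolle_finset hF X hXz
    have hE' := hE.2
    simp only [zero_mul, add_zero] at hE'
    have hh := EP.eq_zero2 _ (fun t => deriv F t) hE' (Z' ∪ X) {z} (by
      intro w hw
      rcases Finset.mem_union.1 hw with hw | hw
      · exact hZ1 w hw
      · exact hXd w hw) (by
      intro w hw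
      rw [Finset.mem_singleton.1 hw]
      exact Finset.mem_union_right _ hz) (by
      intro w hw
      rw [Finset.mem_singleton.1 hw]
      exact hzz) ⟨z, Finset.mem_union_right _ hz⟩ (by
        rw [Finset.card_union_of_disjoint hZ2]
        simp
        omega)
    have hc := is_const_of_deriv_eq_zero hF hh 0 z
    rw [hF0, hXz z hz] at hc
    exact one_ne_zero hc
  have hle : ∀ t, 0 < t → ∑ k, ω k * Real.exp (-(a k) * t) ≤ 1 / t := by
    intro t ht
    have := nn_of_double hF (by rw [hF0]; exact one_pos) X hXd hall hdd ht
    rw [le_div_iff₀ ht]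
    simp only [F] at this
    linarith
  refine ⟨ω, a, hωpos, fun k => ?_, h1, h2, hle⟩
  by_contra hk
  push Not at hk
  have hp := hωpos k
  have ht : 0 < 2 / ω k := by positivity
  have h3 := hle _ ht
  have h4 : ω k * Real.exp (-(a k) * (2 / ω k)) ≤ ∑ k', ω k' * Real.exp (-(a k') * (2 / ω k)) :=
    Finset.single_le_sum (f := fun k' => ω k' * Real.exp (-(a k') * (2 / ω k)))
      (fun i _ => by have := hωpos i; positivity) (Finset.mem_univ k)
  have h5 : 1 ≤ Real.exp (-(a k) * (2 / ω k)) := Real.one_le_exp (mul_nonneg (by linarith) ht.le)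
  have h6 : 1 / (2 / ω k) = ω k / 2 := by field_simp
  rw [h6] at h3
  nlinarith
/-- right half plane -/
def HP : Set ℂ := {w | 0 < w.re}

lemma HP_open : IsOpen HP := isOpen_lt continuous_const Complex.continuous_re

lemma HP_ofReal {a : ℝ} (ha : 0 < a) : (a : ℂ) ∈ HP := by simpa [HP] using ha

lemma hp_step {a : ℝ} (ha : 0 < a) {q : ℂ → ℂ} (hq : DifferentiableOn ℂ q HP) {M : ℝ}
    (hM : ∀ w ∈ HP, ‖(w - a) * q w‖ ≤ M) : ∀ w ∈ HP, ‖(w + a) * q w‖ ≤ M := by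
  have hne : ∀ w ∈ HP, w + a ≠ 0 := by
    intro w hw h
    have := congrArg Complex.re h
    simp [HP] at this hw
    linarith
  have key : ∀ w ∈ HP, w ≠ a → ‖(w + a) * q w‖ ≤ M := by
    intro w hw hwa
    let c : ℂ → ℂ := fun ζ => a * (1 + ζ) / (1 - ζ)
    let G : ℂ → ℂ := fun ζ => (c ζ - a) * q (c ζ)
    have hne1 : ∀ ζ ∈ Metric.ball (0 : ℂ) 1, 1 - ζ ≠ 0 := by
      intro ζ hζ h
      have : ζ = 1 := (sub_eq_zero.1 h).symm
      rw [this] at hζ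
      simp at hζ
    have hc : Set.MapsTo c (Metric.ball 0 1) HP := by
      intro ζ hζ
      have hn := hne1 ζ hζ
      have hz : ‖ζ‖ < 1 := by simpa using hζ
      have hz2 : Complex.normSq ζ < 1 := by
        rw [Complex.normSq_eq_norm_sq]
        nlinarith [norm_nonneg ζ]
      have hpos : 0 < Complex.normSq (1 - ζ) := Complex.normSq_pos.2 hn
      simp only [HP, Set.mem_ofPred_eq, c, Complex.div_re]
      rw [← add_div]
      refine div_pos ?_ hpos
      rw [Complex.normSq_apply] at hz2
      simp
      nlinarith
    have hcd : DifferentiableOn ℂ c (Metric.ball 0 1) := by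
      refine DifferentiableOn.div (by fun_prop) (by fun_prop) hne1
    have hGd : DifferentiableOn ℂ G (Metric.ball 0 1) :=
      (hcd.sub_const _).mul (hq.comp hcd hc)
    have hG0 : G 0 = 0 := by simp [G, c]
    have hGm : Set.MapsTo G (Metric.ball 0 1) (Metric.closedBall (G 0) M) := by
      intro ζ hζ
      rw [hG0]
      simpa [G] using hM _ (hc hζ)
    set ζ : ℂ := (w - a) / (w + a) with hζd
    have hwpa := hne w hw
    have ha' : (a : ℂ) ≠ 0 := by exact_mod_cast ha.ne'
    have h1 : 1 - ζ = 2 * a / (w + a) := by rw [hζd]; field_simp; ring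
    have h1n : 1 - ζ ≠ 0 := by
      rw [h1]; exact div_ne_zero (mul_ne_zero two_ne_zero ha') hwpa
    have hcζ : c ζ = w := by
      simp only [c]
      rw [div_eq_iff h1n, h1, hζd]
      field_simp; ring
    have hζb : ζ ∈ Metric.ball (0 : ℂ) 1 := by
      simp only [mem_ball_zero_iff, hζd, norm_div]
      rw [div_lt_one (norm_pos_iff.2 hwpa)]
      refine lt_of_pow_lt_pow_left₀ 2 (norm_nonneg _) ?_
      rw [← Complex.normSq_eq_norm_sq, ← Complex.normSq_eq_norm_sq, Complex.normSq_apply,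
        Complex.normSq_apply]
      have : 0 < w.re := hw
      simp
      nlinarith [mul_pos this ha]
    have h := Complex.dist_le_div_mul_dist_of_mapsTo_ball hGd hGm hζb
    rw [hG0, dist_zero_right, dist_zero_right, div_one] at h
    have hGζ : G ζ = (w - a) * q w := by simp only [G, hcζ]
    rw [hGζ, hζd, norm_mul, norm_div] at h
    have hp1 : 0 < ‖w - a‖ := norm_pos_iff.2 (sub_ne_zero.2 hwa)
    have hp2 : 0 < ‖w + a‖ := norm_pos_iff.2 hwpa
    rw [norm_mul]
    rw [mul_div_assoc', le_div_iff₀ hp2] at h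
    have : ‖w - a‖ * (‖w + a‖ * ‖q w‖) ≤ ‖w - a‖ * M := by linarith
    exact le_of_mul_le_mul_left this hp1
  intro w hw
  by_cases hwa : w = a
  · have hcont : ContinuousAt (fun w => ‖(w + a) * q w‖) w :=
      ((continuousAt_id.add continuousAt_const).mul
        (hq.continuousOn.continuousAt (HP_open.mem_nhds hw))).norm
    have h1 : Filter.Tendsto (fun w => ‖(w + a) * q w‖) (nhdsWithin w {w}ᶜ)
      (nhds (‖(w + a) * q w‖)) := hcont.continuousWithinAt
    refine le_of_tendsto h1 ?_
    filter_upwards [nhdsWithin_le_nhds (HP_open.mem_nhds hw), self_mem_nhdsWithin] with v hv hv2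
    exact key v hv (by rw [← hwa]; exact hv2)
  · exact key w hw hwa

lemma hp_factor {ι : Type*} (s : Finset ι) (y : ι → ℝ) (hy : ∀ i, 0 < y i)
    (hinj : Function.Injective y) {h : ℂ → ℂ} (hd : DifferentiableOn ℂ h HP)
    (h0 : ∀ i, h (y i) = 0) (h1 : ∀ i, deriv h (y i) = 0) :
    ∃ q : ℂ → ℂ, DifferentiableOn ℂ q HP ∧ ∀ w ∈ HP, h w = (∏ i ∈ s, (w - y i) ^ 2) * q w := by
  classical
  induction s using Finset.induction_on with
  | empty => exact ⟨h, hd, by simp⟩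
  | insert b s hb ih =>
    obtain ⟨q, hq, hhq⟩ := ih
    have hbm : (y b : ℂ) ∈ HP := HP_ofReal (hy b)
    have hnb : HP ∈ nhds (y b : ℂ) := HP_open.mem_nhds hbm
    have hP : ∏ i ∈ s, ((y b : ℂ) - y i) ^ 2 ≠ 0 := by
      refine Finset.prod_ne_zero_iff.2 fun i hi => pow_ne_zero 2 ?_
      rw [sub_ne_zero]
      intro he
      have : y b = y i := by exact_mod_cast he
      exact hb (hinj this ▸ hi)
    have hq0 : q (y b) = 0 := by
      have := hhq _ hbm
      rw [h0 b] at this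
      exact (mul_eq_zero.1 this.symm).resolve_left hP
    have hq1 : deriv q (y b) = 0 := by
      have e : h =ᶠ[nhds (y b : ℂ)] fun w => (∏ i ∈ s, (w - y i) ^ 2) * q w := by
        filter_upwards [hnb] with w hw using hhq w hw
      have hdP : DifferentiableAt ℂ (fun w : ℂ => ∏ i ∈ s, (w - y i) ^ 2) (y b) := by
        fun_prop
      have hdq : DifferentiableAt ℂ q (y b) := hq.differentiableAt hnb
      have h2 := e.deriv_eq
      rw [h1 b, deriv_fun_mul hdP hdq, hq0, mul_zero, zero_add] at h2
      exact (mul_eq_zero.1 h2.symm).resolve_left hP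
    have hd1 : DifferentiableOn ℂ (dslope q (y b)) HP := (Complex.differentiableOn_dslope hnb).2 hq
    have hd2 : DifferentiableOn ℂ (dslope (dslope q (y b)) (y b)) HP :=
      (Complex.differentiableOn_dslope hnb).2 hd1
    refine ⟨_, hd2, fun w hw => ?_⟩
    have e1 : q w = (w - y b) * dslope q (y b) w := by
      have := sub_smul_dslope q (y b : ℂ) w
      rw [hq0, sub_zero] at this
      exact this.symm
    have e2 : dslope q (y b) w = (w - y b) * dslope (dslope q (y b)) (y b) w := by
      have := sub_smul_dslope (dslope q (y b)) (y b : ℂ) w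
      rw [dslope_same, hq1, sub_zero] at this
      exact this.symm
    rw [hhq w hw, Finset.prod_insert hb, e1]
    rw [e2]
    ring

lemma hp_peel {ι : Type*} (s : Finset ι) (y : ι → ℝ) (hy : ∀ i, 0 < y i) {M : ℝ} :
    ∀ q : ℂ → ℂ, DifferentiableOn ℂ q HP →
    (∀ w ∈ HP, ‖(∏ i ∈ s, (w - y i) ^ 2) * q w‖ ≤ M) →
    ∀ w ∈ HP, ‖(∏ i ∈ s, (w + y i) ^ 2) * q w‖ ≤ M := by
  classical
  induction s using Finset.induction_on with
  | empty => exact fun q hq h => h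
  | insert b s hb ih =>
    intro q hq h
    have hR : DifferentiableOn ℂ (fun w : ℂ => ∏ i ∈ s, (w - y i) ^ 2) HP := by
      fun_prop
    have s1 := hp_step (hy b) (q := fun w => (w - y b) * ((∏ i ∈ s, (w - y i) ^ 2) * q w)) (M := M)
      ((by fun_prop : DifferentiableOn ℂ (fun w : ℂ => w - y b) HP).mul (hR.mul hq)) (by
        intro w hw
        have := h w hw
        rw [Finset.prod_insert hb] at this
        convert this using 2
        ring)
    have s2 := hp_step (hy b) (q := fun w => (w + y b) * ((∏ i ∈ s, (w - y i) ^ 2) * q w)) (M := M)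
      ((by fun_prop : DifferentiableOn ℂ (fun w : ℂ => w + y b) HP).mul (hR.mul hq)) (by
        intro w hw
        have := s1 w hw
        convert this using 2
        ring)
    have s3 := ih (fun w => (w + y b) ^ 2 * q w)
      ((by fun_prop : DifferentiableOn ℂ (fun w : ℂ => (w + y b) ^ 2) HP).mul hq) (by
        intro w hw
        have := s2 w hw
        convert this using 2
        ring)
    intro w hw
    have := s3 w hw
    rw [Finset.prod_insert hb]
    convert this using 2
    ring

theorem hp_bound {ι : Type*} [Fintype ι] (y : ι → ℝ) (hy : ∀ i, 0 < y i)
    (hinj : Function.Injective y) {h : ℂ → ℂ} (hd : DifferentiableOn ℂ h HP)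
    (h0 : ∀ i, h (y i) = 0) (h1 : ∀ i, deriv h (y i) = 0) {M : ℝ} (hM : ∀ w ∈ HP, ‖h w‖ ≤ M)
    (X : ℝ) (hX : 0 < X) : ‖h X‖ ≤ M * ∏ i, ((X - y i) / (X + y i)) ^ 2 := by
  obtain ⟨q, hq, hhq⟩ := hp_factor Finset.univ y hy hinj hd h0 h1
  have hXm := HP_ofReal hX
  have hp := hp_peel Finset.univ y hy (M := M) q hq (fun w hw => by rw [← hhq w hw]; exact hM w hw) X hXm
  have e1 : ‖∏ i, ((X : ℂ) + y i) ^ 2‖ = ∏ i, (X + y i) ^ 2 := by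
    have : ∏ i, ((X : ℂ) + y i) ^ 2 = ((∏ i, (X + y i) ^ 2 : ℝ) : ℂ) := by push_cast; rfl
    rw [this, Complex.norm_real, Real.norm_eq_abs, abs_of_nonneg]
    exact Finset.prod_nonneg fun i _ => sq_nonneg _
  have e2 : ‖∏ i, ((X : ℂ) - y i) ^ 2‖ = ∏ i, (X - y i) ^ 2 := by
    have : ∏ i, ((X : ℂ) - y i) ^ 2 = ((∏ i, (X - y i) ^ 2 : ℝ) : ℂ) := by push_cast; rfl
    rw [this, Complex.norm_real, Real.norm_eq_abs, abs_of_nonneg]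
    exact Finset.prod_nonneg fun i _ => sq_nonneg _
  have hpos : 0 < ∏ i, (X + y i) ^ 2 := Finset.prod_pos fun i _ => by have := hy i; positivity
  rw [norm_mul, e1] at hp
  rw [hhq _ hXm, norm_mul, e2]
  simp only [div_pow, Finset.prod_div_distrib]
  rw [mul_div_assoc', le_div_iff₀ hpos]
  have := mul_le_mul_of_nonneg_left hp (Finset.prod_nonneg (s := Finset.univ) fun i _ => sq_nonneg (X - y i))
  linarith
/-- complex exponential sum -/
noncomputable def CS {r : ℕ} (ω a : Fin r → ℝ) (z : ℂ) : ℂ := ∑ k, (ω k : ℂ) * Complex.exp (-(a k) * z)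

lemma CS_ofReal {r : ℕ} (ω a : Fin r → ℝ) (x : ℝ) :
    CS ω a x = ((∑ k, ω k * Real.exp (-(a k) * x) : ℝ) : ℂ) := by
  simp [CS]

lemma CS_hasDerivAt {r : ℕ} (ω a : Fin r → ℝ) (z : ℂ) :
    HasDerivAt (CS ω a) (-∑ k, (ω k : ℂ) * a k * Complex.exp (-(a k) * z)) z := by
  unfold CS
  rw [← Finset.sum_neg_distrib]
  refine HasDerivAt.fun_sum fun k _ => ?_
  have h2 : HasDerivAt (fun z : ℂ => Complex.exp (-(a k) * z)) (Complex.exp (-(a k) * z) * (-(a k))) z := by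
    simpa using ((hasDerivAt_id z).const_mul (-(a k) : ℂ)).cexp
  exact (h2.const_mul _).congr_deriv (by ring)

lemma CS_norm {r : ℕ} (ω a : Fin r → ℝ) (hω : ∀ k, 0 < ω k) (z : ℂ) :
    ‖CS ω a z‖ ≤ ∑ k, ω k * Real.exp (-(a k) * z.re) := by
  unfold CS
  refine (norm_sum_le _ _).trans (Finset.sum_le_sum fun k _ => ?_)
  rw [norm_mul, Complex.norm_real, Complex.norm_exp, Real.norm_eq_abs, abs_of_pos (hω k)]
  simp

lemma CS_deriv_ofReal {r : ℕ} (ω a : Fin r → ℝ) (x : ℝ) :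
    ∑ k, (ω k : ℂ) * a k * Complex.exp (-(a k) * x) = ((∑ k, ω k * a k * Real.exp (-(a k) * x) : ℝ) : ℂ) := by
  simp

theorem small_bound {r : ℕ} (ω a : Fin r → ℝ) (hω : ∀ k, 0 < ω k) (y : Fin r → ℝ) (ha : ∀ k, 0 < a k)
    (hy : ∀ i, 0 < y i) (hinj : Function.Injective y)
    (h0 : ∀ i, ∑ k, ω k * Real.exp (-(a k) * ((y i + 1) / 2)) = 1 / ((y i + 1) / 2))
    (h1 : ∀ i, ∑ k, ω k * a k * Real.exp (-(a k) * ((y i + 1) / 2)) = 1 / ((y i + 1) / 2) ^ 2)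
    (hle : ∀ t, 0 < t → ∑ k, ω k * Real.exp (-(a k) * t) ≤ 1 / t) (x : ℝ) (hx : 1 ≤ x) :
    1 / x - ∑ k, ω k * Real.exp (-(a k) * x) ≤ 4 * ∏ i, ((2 * x - 1 - y i) / (2 * x - 1 + y i)) ^ 2 := by
  let h : ℂ → ℂ := fun w => ((w + 1) / 2)⁻¹ - CS ω a ((w + 1) / 2)
  have hne : ∀ w ∈ HP, (w + 1) / 2 ≠ 0 := by
    intro w hw he
    have := congrArg Complex.re he
    simp [HP] at this hw
    linarith
  have hd : ∀ w ∈ HP, HasDerivAt h ((-(((w + 1) / 2) ^ 2)⁻¹ +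
      ∑ k, (ω k : ℂ) * a k * Complex.exp (-(a k) * ((w + 1) / 2))) / 2) w := by
    intro w hw
    have hl : HasDerivAt (fun w : ℂ => (w + 1) / 2) (1 / 2) w :=
      ((hasDerivAt_id w).add_const 1).div_const 2
    have e1 := hl.fun_inv (hne w hw)
    have e2 := (CS_hasDerivAt ω a ((w + 1) / 2)).comp w hl
    refine (e1.sub e2).congr_deriv ?_
    field_simp
    ring
  have hcast : ∀ i, (((y i : ℝ) : ℂ) + 1) / 2 = (((y i + 1) / 2 : ℝ) : ℂ) := fun i => by push_cast; rfl
  have hb := hp_bound y hy hinj (h := h) (fun w hw => (hd w hw).differentiableAt.differentiableWithinAt)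
    (fun i => by
      simp only [h]
      rw [hcast, CS_ofReal, h0 i]
      push_cast
      simp)
    (fun i => by
      rw [(hd _ (HP_ofReal (hy i))).deriv, hcast, CS_deriv_ofReal, h1 i]
      push_cast
      simp) (M := 4) (by
      intro w hw
      have hw' : 0 < w.re := hw
      have hre : 1 / 2 ≤ ((w + 1) / 2).re := by
        have : ((w + 1) / 2).re = (w.re + 1) / 2 := by
          rw [show (w + 1) / 2 = (w + 1) / ((2 : ℝ) : ℂ) by simp, Complex.div_ofReal_re]; simp
        rw [this]; linarith
      have hn1 : ‖((w + 1) / 2)⁻¹‖ ≤ 2 := by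
        rw [norm_inv, inv_le_comm₀ (norm_pos_iff.2 (hne w hw)) two_pos]
        have := Complex.re_le_norm ((w + 1) / 2)
        linarith
      have hn2 : ‖CS ω a ((w + 1) / 2)‖ ≤ 2 := by
        refine (CS_norm ω a hω _).trans ?_
        have h3 := hle (1 / 2) (by norm_num)
        rw [show (1 : ℝ) / (1 / 2) = 2 by norm_num] at h3
        refine le_trans (Finset.sum_le_sum fun k _ => ?_) h3
        refine mul_le_mul_of_nonneg_left (Real.exp_le_exp.2 ?_) (hω k).le
        have := ha k
        nlinarith
      exact (norm_sub_le _ _).trans (by linarith)) (2 * x - 1) (by linarith)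
  have e : h ((2 * x - 1 : ℝ) : ℂ) = ((1 / x - ∑ k, ω k * Real.exp (-(a k) * x) : ℝ) : ℂ) := by
    simp only [h]
    have : (((2 * x - 1 : ℝ) : ℂ) + 1) / 2 = (x : ℂ) := by push_cast; ring
    rw [this, CS_ofReal]
    push_cast
    simp
  rw [e, Complex.norm_real] at hb
  exact (le_abs_self _).trans hb

lemma cos_two_pi_div_five : Real.cos (2 * Real.pi / 5) = (√5 - 1) / 4 := by
  have : 2 * Real.pi / 5 = 2 * (Real.pi / 5) := by ring
  rw [this, Real.cos_two_mul, Real.cos_pi_div_five]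
  have := Real.sq_sqrt (show (0 : ℝ) ≤ 5 by norm_num)
  nlinarith

theorem large_bound {r : ℕ} (ω a : Fin r → ℝ) (hω : ∀ k, 0 < ω k) (y : Fin r → ℝ)
    (hy : ∀ i, 0 < y i) (hinj : Function.Injective y)
    (h0 : ∀ i, ∑ k, ω k * Real.exp (-(a k) * ((y i) ^ (4 / 5 : ℝ))) = 1 / ((y i) ^ (4 / 5 : ℝ)))
    (h1 : ∀ i, ∑ k, ω k * a k * Real.exp (-(a k) * ((y i) ^ (4 / 5 : ℝ))) = 1 / ((y i) ^ (4 / 5 : ℝ)) ^ 2)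
    (hle : ∀ t, 0 < t → ∑ k, ω k * Real.exp (-(a k) * t) ≤ 1 / t) (X : ℝ) (hX : 0 < X) :
    1 - X ^ (4 / 5 : ℝ) * ∑ k, ω k * Real.exp (-(a k) * X ^ (4 / 5 : ℝ)) ≤
      (2 + √5) * ∏ i, ((X - y i) / (X + y i)) ^ 2 := by
  let p : ℂ → ℂ := fun w => w ^ ((4 / 5 : ℝ) : ℂ)
  let h : ℂ → ℂ := fun w => 1 - p w * CS ω a (p w)
  have hp : ∀ w ∈ HP, ∃ p', HasDerivAt p p' w := by
    intro w hw
    exact ⟨_, (hasDerivAt_id w).cpow_const (Or.inl hw)⟩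
  choose! p' hp' using hp
  have hd : ∀ w ∈ HP, HasDerivAt h ((-CS ω a (p w) +
      p w * ∑ k, (ω k : ℂ) * a k * Complex.exp (-(a k) * p w)) * p' w) w := by
    intro w hw
    have hl := hp' w hw
    have e2 := (CS_hasDerivAt ω a (p w)).comp w hl
    refine ((hl.mul e2).const_sub 1).congr_deriv ?_
    simp only [Function.comp]
    ring
  have hcast : ∀ x : ℝ, 0 < x → p (x : ℂ) = ((x ^ (4 / 5 : ℝ) : ℝ) : ℂ) := fun x hx => by
    simp only [p]
    rw [Complex.ofReal_cpow hx.le]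
  have hb := hp_bound y hy hinj (h := h) (fun w hw => (hd w hw).differentiableAt.differentiableWithinAt)
    (fun i => by
      have : y i ^ (4 / 5 : ℝ) ≠ 0 := (Real.rpow_pos_of_pos (hy i) _).ne'
      simp only [h]
      rw [hcast _ (hy i), CS_ofReal, h0 i, ← Complex.ofReal_mul, mul_one_div_cancel this]
      simp)
    (fun i => by
      have : y i ^ (4 / 5 : ℝ) ≠ 0 := (Real.rpow_pos_of_pos (hy i) _).ne'
      rw [(hd _ (HP_ofReal (hy i))).deriv, hcast _ (hy i), CS_deriv_ofReal, h1 i, CS_ofReal, h0 i,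
        ← Complex.ofReal_mul, ← Complex.ofReal_neg, ← Complex.ofReal_add]
      have e : -(1 / y i ^ (4 / 5 : ℝ)) + y i ^ (4 / 5 : ℝ) * (1 / (y i ^ (4 / 5 : ℝ)) ^ 2) = 0 := by
        field_simp; ring
      rw [e]; simp) (M := 2 + √5) (by
      intro w hw
      have hw' : 0 < w.re := hw
      have hw0 : w ≠ 0 := fun he => by rw [he] at hw'; simp at hw'
      have harg : |w.arg| < Real.pi / 2 := Complex.abs_arg_lt_pi_div_two_iff.2 (Or.inl hw')
      have hpi := Real.pi_pos
      have hre : (p w).re = ‖p w‖ * Real.cos (4 / 5 * w.arg) := by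
        simp only [p]
        rw [Complex.norm_cpow_real, Complex.cpow_def_of_ne_zero hw0, Complex.exp_re]
        congr 1
        · rw [Real.rpow_def_of_pos (norm_pos_iff.2 hw0)]
          simp [Complex.log_re]
        · simp [Complex.log_im]; ring_nf
      have hcos : (√5 - 1) / 4 ≤ Real.cos (4 / 5 * w.arg) := by
        rw [← cos_two_pi_div_five, ← Real.cos_abs (4 / 5 * w.arg)]
        refine Real.cos_le_cos_of_nonneg_of_le_pi (abs_nonneg _) (by linarith) ?_
        rw [abs_mul, abs_of_pos (by norm_num : (0 : ℝ) < 4 / 5)]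
        linarith
      have h5 : 2 < √5 := by
        rw [Real.lt_sqrt (by norm_num)]; norm_num
      have h55 := Real.sq_sqrt (show (0 : ℝ) ≤ 5 by norm_num)
      have hpn : 0 < ‖p w‖ := by
        simp only [p]; rw [Complex.norm_cpow_real]
        exact Real.rpow_pos_of_pos (norm_pos_iff.2 hw0) _
      have hrep : 0 < (p w).re := by
        rw [hre]; exact mul_pos hpn (by linarith)
      have hn2 : ‖p w‖ * ‖CS ω a (p w)‖ ≤ √5 + 1 := by
        have h6 := (CS_norm ω a hω (p w)).trans (hle _ hrep)
        have h7 : ‖p w‖ * ‖CS ω a (p w)‖ ≤ ‖p w‖ * (1 / (p w).re) :=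
          mul_le_mul_of_nonneg_left h6 hpn.le
        refine h7.trans ?_
        rw [mul_one_div, div_le_iff₀ hrep, hre]
        have : 1 ≤ (√5 + 1) * Real.cos (4 / 5 * w.arg) := by nlinarith
        nlinarith
      simp only [h]
      refine (norm_sub_le _ _).trans ?_
      rw [norm_mul, norm_one]
      linarith) X hX
  have e : h (X : ℂ) = ((1 - X ^ (4 / 5 : ℝ) * ∑ k, ω k * Real.exp (-(a k) * X ^ (4 / 5 : ℝ)) : ℝ) : ℂ) := by
    simp only [h]
    rw [hcast X hX, CS_ofReal]
    push_cast
    simp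
  rw [e, Complex.norm_real] at hb
  exact (le_abs_self _).trans hb
/-- normalised (β = 1) version of the claim -/
def Core (r : ℕ) : Prop :=
  ∃ ω a : Fin r → ℝ, (∀ k, 0 < ω k) ∧ (∀ k, 0 < a k) ∧
    (∀ x : ℝ, 1 ≤ x → |1 / x - ∑ k, ω k * Real.exp (-(a k) * x)|
      ≤ 16 * Real.exp (-(Real.pi * √(r : ℝ)))) ∧
    (∀ x : ℝ, 0 < x → ∑ k, ω k * Real.exp (-(a k) * x) ≤ 1 / x)

theorem core_small {r : ℕ} (hr : 1 ≤ r) (y : Fin r → ℝ) (hy : ∀ i, 0 < y i)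
    (hinj : Function.Injective y) (N c : ℝ) (hN : Real.exp (Real.pi * √(r : ℝ)) ≤ N)
    (hc : c ^ 2 * N ≤ 4)
    (hb : ∀ Y : ℝ, 1 ≤ Y → Y ≤ N / 8 - 1 → |∏ i, (Y - y i)| ≤ c * ∏ i, (Y + y i)) : Core r := by
  have hNpos : 0 < N := (Real.exp_pos _).trans_le hN
  obtain ⟨ω, a, hω, ha, h0, h1, hle⟩ := interp_pos hr (fun i => (y i + 1) / 2)
    (fun i j hij => hinj (by simp only at hij; linarith)) (fun i => by have := hy i; positivity)
  refine ⟨ω, a, hω, ha, fun x hx => ?_, hle⟩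
  have hx0 : 0 < x := by linarith
  have hexp : 16 / N ≤ 16 * Real.exp (-(Real.pi * √(r : ℝ))) := by
    rw [Real.exp_neg, div_eq_mul_inv]
    have := inv_anti₀ (Real.exp_pos _) hN
    linarith
  rw [abs_of_nonneg (by have := hle x hx0; linarith)]
  refine le_trans ?_ hexp
  rcases le_total (N / 16) x with h | h
  · have hs : 0 ≤ ∑ k, ω k * Real.exp (-(a k) * x) :=
      Finset.sum_nonneg fun k _ => by have := hω k; positivity
    have : 1 / x ≤ 16 / N := by
      rw [div_le_div_iff₀ hx0 hNpos]; linarith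
    linarith
  · have hs := small_bound ω a hω y ha hy hinj h0 h1 hle x hx
    refine hs.trans ?_
    have hB := hb (2 * x - 1) (by linarith) (by linarith)
    have hP : 0 < ∏ i, (2 * x - 1 + y i) := Finset.prod_pos fun i _ => by
      have := hy i; linarith
    rw [Finset.prod_pow, Finset.prod_div_distrib, div_pow]
    have h2 : (∏ i, (2 * x - 1 - y i)) ^ 2 ≤ (c * ∏ i, (2 * x - 1 + y i)) ^ 2 :=
      sq_le_sq' (by linarith [neg_abs_le (∏ i, (2 * x - 1 - y i))]) ((le_abs_self _).trans hB)
    have h3 : (∏ i, (2 * x - 1 - y i)) ^ 2 / (∏ i, (2 * x - 1 + y i)) ^ 2 ≤ c ^ 2 := by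
      rw [div_le_iff₀ (by positivity)]; linarith
    rw [le_div_iff₀ hNpos]
    nlinarith

/-- natural number distance -/
def nd (p y : ℕ) : ℕ := (p - y) + (y - p)

lemma nd_cast (p y : ℕ) : ((nd p y : ℕ) : ℝ) = |(p : ℝ) - y| := by
  unfold nd
  rcases le_total p y with h | h
  · rw [Nat.sub_eq_zero_of_le h, abs_of_nonpos (by simpa using h)]
    push_cast [h]; ring
  · rw [Nat.sub_eq_zero_of_le h, abs_of_nonneg (by simpa using h)]
    push_cast [h]; ring

def mx (a b : ℕ) : ℕ := bif Nat.ble a b then b else a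

lemma mx_eq (a b : ℕ) : mx a b = max a b := by
  unfold mx
  cases h : Nat.ble a b with
  | true => simp [Nat.le_of_ble_eq_true h]
  | false =>
    have : ¬ a ≤ b := fun hh => by rw [Nat.ble_eq_true_of_le hh] at h; simp at h
    simp; omega

def cnum (p q : ℕ) : List ℕ → ℕ
  | [] => 1
  | y :: l => mx (nd p y * (q + y)) (nd q y * (p + y)) * cnum p q l

def cden (p q : ℕ) : List ℕ → ℕ
  | [] => 1
  | y :: l => ((p + y) * (q + y)) * cden p q l

def crun (ys : List ℕ) (m B cn cd : ℕ) : ℕ → ℕ → Bool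
  | 0, p => Nat.ble B p
  | n + 1, p => Nat.ble B p || (Nat.ble (cnum p (p + p / m) ys * cd) (cn * cden p (p + p / m) ys) &&
      crun ys m B cn cd n (p + p / m))

lemma cfac (p q y : ℕ) (Z : ℝ) (h1 : (p : ℝ) ≤ Z) (h2 : Z ≤ q) :
    |Z - y| * (((p + y) * (q + y) : ℕ) : ℝ) ≤
      ((mx (nd p y * (q + y)) (nd q y * (p + y)) : ℕ) : ℝ) * (Z + y) := by
  rw [mx_eq]
  push_cast
  rw [nd_cast, nd_cast]
  have hp : (0 : ℝ) ≤ p := p.cast_nonneg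
  have hy : (0 : ℝ) ≤ y := y.cast_nonneg
  rcases le_total Z y with h | h
  · have h3 : |(p : ℝ) - y| = y - p := by rw [abs_of_nonpos (by linarith)]; ring
    rw [abs_of_nonpos (by linarith)]
    refine le_trans ?_ (mul_le_mul_of_nonneg_right (le_max_left _ _) (by linarith))
    rw [h3]
    have : -(Z - y) * (p + y) ≤ (y - p) * (Z + y) := by nlinarith
    nlinarith
  · have h3 : |(q : ℝ) - y| = q - y := abs_of_nonneg (by linarith)
    rw [abs_of_nonneg (by linarith)]
    refine le_trans ?_ (mul_le_mul_of_nonneg_right (le_max_right _ _) (by linarith))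
    rw [h3]
    have : (Z - y) * (q + y) ≤ (q - y) * (Z + y) := by nlinarith
    nlinarith

lemma cprod (p q : ℕ) (Z : ℝ) (h1 : (p : ℝ) ≤ Z) (h2 : Z ≤ q) (ys : List ℕ) :
    |(ys.map fun y : ℕ => Z - (y : ℝ)).prod| * (cden p q ys : ℝ) ≤
      (cnum p q ys : ℝ) * (ys.map fun y : ℕ => Z + (y : ℝ)).prod := by
  have hp : (0 : ℝ) ≤ p := p.cast_nonneg
  induction ys with
  | nil => simp [cden, cnum]
  | cons y l ih =>
    have hf := cfac p q y Z h1 h2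
    simp only [List.map_cons, List.prod_cons, abs_mul, cden, cnum]
    rw [Nat.cast_mul _ (cden p q l), Nat.cast_mul _ (cnum p q l)]
    have := mul_le_mul hf ih (by positivity) (mul_nonneg (by positivity) (by
      have : (0 : ℝ) ≤ y := y.cast_nonneg
      linarith))
    calc _ = _ := by ring
      _ ≤ _ := this
      _ = _ := by ring

lemma cden_pos {p q : ℕ} (hp : 0 < p) (hq : 0 < q) : ∀ ys : List ℕ, 0 < cden p q ys
  | [] => one_pos
  | y :: l => by
    have := cden_pos hp hq l
    unfold cden
    positivity

lemma crun_sound (ys : List ℕ) (m B cn cd : ℕ) : ∀ n p : ℕ, 0 < p → crun ys m B cn cd n p = true →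
    ∀ Z : ℝ, (p : ℝ) ≤ Z → Z < B →
      |(ys.map fun y : ℕ => Z - (y : ℝ)).prod| * cd ≤ cn * (ys.map fun y : ℕ => Z + (y : ℝ)).prod
  | 0, p, hp, h, Z, h1, h2 => by
    have : (B : ℝ) ≤ p := by exact_mod_cast Nat.le_of_ble_eq_true h
    linarith
  | n + 1, p, hp, h, Z, h1, h2 => by
    simp only [crun, Bool.or_eq_true, Bool.and_eq_true] at h
    rcases h with h | ⟨h, h'⟩
    · have : (B : ℝ) ≤ p := by exact_mod_cast Nat.le_of_ble_eq_true h
      linarith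
    · rcases le_total Z ((p + p / m : ℕ) : ℝ) with hz | hz
      · have hc := cprod p (p + p / m) Z h1 hz ys
        have hd : (0 : ℝ) < cden p (p + p / m) ys := by
          exact_mod_cast cden_pos hp (Nat.add_pos_left hp _) ys
        have hk : ((cnum p (p + p / m) ys : ℕ) : ℝ) * cd ≤ cn * (cden p (p + p / m) ys : ℕ) := by
          exact_mod_cast Nat.le_of_ble_eq_true h
        have hP : 0 ≤ (ys.map fun y : ℕ => Z + (y : ℝ)).prod := by
          refine List.prod_nonneg fun z hz => ?_
          obtain ⟨y, -, rfl⟩ := List.mem_map.1 hz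
          have : (0 : ℝ) < p := by exact_mod_cast hp
          have : (0 : ℝ) ≤ y := y.cast_nonneg
          show (0 : ℝ) ≤ Z + y
          linarith
        refine le_of_mul_le_mul_right ?_ hd
        have i1 := mul_le_mul_of_nonneg_right hc (show (0 : ℝ) ≤ cd from cd.cast_nonneg)
        have i2 := mul_le_mul_of_nonneg_right hk hP
        linarith
      · exact crun_sound ys m B cn cd n _ (Nat.add_pos_left hp _) h' Z hz h2

theorem core_chk (ys : List ℕ) (D m n cn cd f e : ℕ) (hlen : 1 ≤ ys.length) (hD : 0 < D) (hcd : 0 < cd)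
    (hyp : ∀ y ∈ ys, 0 < y) (hnd : ys.Nodup)
    (hpi : (3.1416 : ℝ) ^ 2 * (ys.length : ℝ) ≤ ((e : ℝ) / 20) ^ 2)
    (hexp : (2.7182818286 : ℝ) ^ e ≤ (8 * n : ℝ) ^ 20)
    (hc : 2 * cn ^ 2 * n ≤ cd ^ 2)
    (hrun : crun ys m (D * (n - 1) + 1) cn cd f D = true) : Core ys.length := by
  have hDr : (0 : ℝ) < D := by exact_mod_cast hD
  have hcr : (0 : ℝ) < cd := by exact_mod_cast hcd
  have e0 : (0 : ℝ) ≤ (e : ℝ) / 20 := by positivity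
  refine core_small hlen (fun i => (ys.get i : ℝ) / D) (fun i => ?_) ?_ (8 * n) (cn / cd) ?_ ?_ ?_
  · have : 0 < ys.get i := hyp _ (List.get_mem _ _)
    have : (0 : ℝ) < (ys.get i : ℝ) := by exact_mod_cast this
    positivity
  · intro i j hij
    have : (ys.get i : ℝ) = ys.get j := by
      have := congrArg (· * (D : ℝ)) hij
      simpa [hDr.ne'] using this
    exact (List.nodup_iff_injective_get.1 hnd) (by exact_mod_cast this)
  · have h1 : Real.pi * √(ys.length : ℝ) ≤ (e : ℝ) / 20 := by
      refine abs_le_of_sq_le_sq' ?_ e0 |>.2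
      rw [mul_pow, Real.sq_sqrt (Nat.cast_nonneg _)]
      refine le_trans ?_ hpi
      refine mul_le_mul_of_nonneg_right ?_ (Nat.cast_nonneg _)
      have := Real.pi_lt_d4
      have := Real.pi_pos
      gcongr
    refine (Real.exp_le_exp.2 h1).trans ?_
    refine le_of_pow_le_pow_left₀ (n := 20) (by norm_num) (by positivity) ?_
    rw [← Real.exp_nat_mul]
    refine le_trans ?_ hexp
    have : ((20 : ℕ) : ℝ) * ((e : ℝ) / 20) = (e : ℝ) * 1 := by push_cast; ring
    rw [this, Real.exp_nat_mul]
    exact pow_le_pow_left₀ (Real.exp_nonneg _) Real.exp_one_lt_d9.le e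
  · rw [div_pow, div_mul_eq_mul_div, div_le_iff₀ (by positivity)]
    have : 2 * (cn : ℝ) ^ 2 * n ≤ (cd : ℝ) ^ 2 := by exact_mod_cast hc
    linarith
  · intro Y hY1 hY2
    have hn : 1 ≤ n := by
      by_contra h
      have : n = 0 := by omega
      rw [this] at hY2
      norm_num at hY2
      linarith
    have hs := crun_sound ys m _ cn cd f D hD hrun (Y * D) (by nlinarith) (by
      push_cast [hn]
      nlinarith)
    have e1 : ∀ g : ℝ → ℝ, ∏ i : Fin ys.length, g (ys.get i : ℝ) = (ys.map fun y : ℕ => g (y : ℝ)).prod := by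
      intro g
      have := Fin.prod_univ_fun_getElem ys (fun y : ℕ => g (y : ℝ))
      simpa using this
    have e2 : ∏ i : Fin ys.length, (Y - (ys.get i : ℝ) / D) =
        (ys.map fun y : ℕ => (Y * D - (y : ℝ))).prod / (D : ℝ) ^ ys.length := by
      rw [← e1 (fun y => Y * D - y), ← Fin.prod_const, ← Finset.prod_div_distrib]
      exact Finset.prod_congr rfl fun i _ => by field_simp
    have e3 : ∏ i : Fin ys.length, (Y + (ys.get i : ℝ) / D) =
        (ys.map fun y : ℕ => (Y * D + (y : ℝ))).prod / (D : ℝ) ^ ys.length := by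
      rw [← e1 (fun y => Y * D + y), ← Fin.prod_const, ← Finset.prod_div_distrib]
      exact Finset.prod_congr rfl fun i _ => by field_simp
    rw [e2, e3, abs_div, abs_of_pos (show (0 : ℝ) < (D : ℝ) ^ ys.length by positivity),
      mul_div_assoc', div_le_div_iff_of_pos_right (by positivity), div_mul_eq_mul_div,
      le_div_iff₀ hcr]
    exact hs
lemma core_1 : Core 1 :=
  core_chk [1414] 1000 2 3 408248 1000000 2 63
    (by decide) (by decide) (by decide) (by decide) (by decide) (by norm_num) (by norm_num) (by norm_num)
    (by decide +kernel)

lemma core_2 : Core 2 :=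
  core_chk [1452, 6889] 1000 2 11 213200 1000000 6 89
    (by decide) (by decide) (by decide) (by decide) (by decide) (by norm_num) (by norm_num) (by norm_num)
    (by decide +kernel)

lemma core_3 : Core 3 :=
  core_chk [1330, 5385, 21800] 1000 3 30 129099 1000000 12 109
    (by decide) (by decide) (by decide) (by decide) (by decide) (by norm_num) (by norm_num) (by norm_num)
    (by decide +kernel)

lemma core_4 : Core 4 :=
  core_chk [1256, 4149, 16388, 54154] 1000 4 69 85125 1000000 19 126
    (by decide) (by decide) (by decide) (by decide) (by decide) (by norm_num) (by norm_num) (by norm_num)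
    (by decide +kernel)

lemma core_5 : Core 5 :=
  core_chk [1209, 3440, 12000, 41864, 119118] 1000 14 145 58722 1000000 73 141
    (by decide) (by decide) (by decide) (by decide) (by decide) (by norm_num) (by norm_num) (by norm_num)
    (by decide +kernel)

lemma core_6 : Core 6 :=
  core_chk [1175, 2969, 9290, 29709, 92967, 234821] 1000 8 277 42485 1000000 48 154
    (by decide) (by decide) (by decide) (by decide) (by decide) (by norm_num) (by norm_num) (by norm_num)
    (by decide +kernel)

lemma core_7 : Core 7 :=
  core_chk [1153, 2676, 7730, 22978, 68307, 197335, 457831] 1000 7 529 30743 1000000 47 167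
    (by decide) (by decide) (by decide) (by decide) (by decide) (by norm_num) (by norm_num) (by norm_num)
    (by decide +kernel)

lemma core_8 : Core 8 :=
  core_chk [1134, 2437, 6535, 18134, 50513, 140162, 375941, 807448] 1000 8 917 23350 1000000 58 178
    (by decide) (by decide) (by decide) (by decide) (by decide) (by norm_num) (by norm_num) (by norm_num)
    (by decide +kernel)

lemma core_9 : Core 9 :=
  core_chk [1121, 2268, 5737, 15078, 39850, 105318, 276809, 700202, 1416996] 1000 14 1589 17738 1000000 107 189
    (by decide) (by decide) (by decide) (by decide) (by decide) (by norm_num) (by norm_num) (by norm_num)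
    (by decide +kernel)

lemma core_10 : Core 10 :=
  core_chk [1109, 2129, 5108, 12785, 32222, 81281, 204849, 512737, 1230045, 2361508] 1000 16 2620 13814 1000000 130 199
    (by decide) (by decide) (by decide) (by decide) (by decide) (by norm_num) (by norm_num) (by norm_num)
    (by decide +kernel)

lemma core_11 : Core 11 :=
  core_chk [1100, 2024, 4646, 11171, 27075, 65711, 159482, 386541, 929312, 2133819, 3925578] 1000 12 4319 10759 1000000 105 209
    (by decide) (by decide) (by decide) (by decide) (by decide) (by norm_num) (by norm_num) (by norm_num)
    (by decide +kernel)

lemma core_12 : Core 12 :=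
  core_chk [1092, 1930, 4252, 9840, 22986, 53789, 125900, 294613, 688221, 1592642, 3507938, 6202572] 1000 14 6773 8592 1000000 128 218
    (by decide) (by decide) (by decide) (by decide) (by decide) (by norm_num) (by norm_num) (by norm_num)
    (by decide +kernel)

lemma core_13 : Core 13 :=
  core_chk [1085, 1856, 3946, 8839, 20013, 45404, 103053, 233898, 530664, 1201458, 2691360, 5721423, 9786377] 1000 12 10621 6861 1000000 116 227
    (by decide) (by decide) (by decide) (by decide) (by decide) (by norm_num) (by norm_num) (by norm_num)
    (by decide +kernel)

lemma core_14 : Core 14 :=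
  core_chk [1080, 1796, 3702, 8064, 17773, 39268, 86801, 191887, 424163, 937139, 2065446, 4498746, 9275617, 15426344] 1000 18 16657 5478 1000000 180 236
    (by decide) (by decide) (by decide) (by decide) (by decide) (by norm_num) (by norm_num) (by norm_num)
    (by decide +kernel)

lemma core_15 : Core 15 :=
  core_chk [1074, 1738, 3476, 7363, 15798, 33996, 73200, 157632, 339456, 730913, 1572825, 3374861, 7147492, 14293725, 23125912] 1000 14 24849 4485 1000000 147 244
    (by decide) (by decide) (by decide) (by decide) (by decide) (by norm_num) (by norm_num) (by norm_num)
    (by decide +kernel)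

lemma core_16 : Core 16 :=
  core_chk [1070, 1690, 3291, 6800, 14252, 29967, 63059, 132713, 279317, 587850, 1236985, 2601008, 5451322, 11263438, 21928286, 34643042] 1000 16 37070 3672 1000000 174 252
    (by decide) (by decide) (by decide) (by decide) (by decide) (by norm_num) (by norm_num) (by norm_num)
    (by decide +kernel)

set_option exponentiation.threshold 1000 in
lemma core_17 : Core 17 :=
  core_chk [1066, 1650, 3137, 6340, 13014, 26811, 55284, 114018, 235162, 485018, 1000300, 2062596, 4249349, 8722437, 17631190, 33518842, 51866015] 1000 24 55302 3006 1000000 268 260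
    (by decide) (by decide) (by decide) (by decide) (by decide) (by norm_num) (by norm_num) (by norm_num)
    (by decide +kernel)

set_option exponentiation.threshold 1000 in
lemma core_18 : Core 18 :=
  core_chk [1062, 1610, 2986, 5901, 11856, 23919, 48303, 97569, 197098, 398158, 804310, 1624673, 3280954, 6619012, 13298217, 26278579, 48750372, 73863718] 1000 28 78477 2524 1000000 322 267
    (by decide) (by decide) (by decide) (by decide) (by decide) (by norm_num) (by norm_num) (by norm_num)
    (by decide +kernel)

set_option exponentiation.threshold 1000 in
lemma core_19 : Core 19 :=
  core_chk [1059, 1575, 2859, 5535, 10908, 21596, 42807, 84874, 168294, 333711, 661717, 1312097, 2601520, 5156544, 10208964, 20119368, 38955379, 70697584, 105143369] 1000 16 111364 2118 1000000 192 274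
    (by decide) (by decide) (by decide) (by decide) (by decide) (by norm_num) (by norm_num) (by norm_num)
    (by decide +kernel)

set_option exponentiation.threshold 1000 in
lemma core_20 : Core 20 :=
  core_chk [1056, 1545, 2749, 5226, 10121, 19700, 38398, 74867, 145988, 284678, 555126, 1082500, 2110833, 4115662, 8021833, 15614570, 30241441, 57482947, 102275787, 149613028] 1000 28 158033 1778 1000000 342 281
    (by decide) (by decide) (by decide) (by decide) (by decide) (by norm_num) (by norm_num) (by norm_num)
    (by decide +kernel)

set_option exponentiation.threshold 1000 in
lemma core_21 : Core 21 :=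
  core_chk [1054, 1519, 2654, 4961, 9458, 18129, 34801, 66834, 128365, 246553, 473560, 909579, 1747039, 3355460, 6443975, 12370290, 23711491, 45202760, 84490695, 147654475, 212824439] 1000 20 224260 1493 1000000 253 288
    (by decide) (by decide) (by decide) (by decide) (by decide) (by norm_num) (by norm_num) (by norm_num)
    (by decide +kernel)

set_option exponentiation.threshold 1000 in
lemma core_22 : Core 22 :=
  core_chk [1051, 1496, 2571, 4733, 8893, 16810, 31825, 60282, 114197, 216342, 409856, 776465, 1470997, 2786745, 5279188, 9999569, 18931948, 35784275, 67240781, 123769427, 212792357, 302661810] 1000 20 318240 1253 1000000 260 295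
    (by decide) (by decide) (by decide) (by decide) (by decide) (by norm_num) (by norm_num) (by norm_num)
    (by decide +kernel)

set_option exponentiation.threshold 1000 in
lemma core_23 : Core 23 :=
  core_chk [1049, 1475, 2498, 4534, 8408, 15689, 29331, 54862, 102632, 192004, 359206, 672013, 1257224, 2352047, 4400216, 8231590, 15396749, 28783859, 53713329, 99604957, 180779447, 306202777, 430323799] 1000 32 451603 1052 1000000 424 302
    (by decide) (by decide) (by decide) (by decide) (by decide) (by norm_num) (by norm_num) (by norm_num)
    (by decide +kernel)

set_option exponentiation.threshold 1000 in
lemma core_24 : Core 24 :=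
  core_chk [1047, 1453, 2422, 4328, 7912, 14561, 26851, 49543, 91429, 168734, 311408, 574722, 1060686, 1957562, 3612785, 6667489, 12304399, 22703006, 41864935, 77045623, 140834043, 251725771, 419534800, 582064500] 1000 28 609601 905 1000000 380 308
    (by decide) (by decide) (by decide) (by decide) (by decide) (by norm_num) (by norm_num) (by norm_num)
    (by decide +kernel)


noncomputable def GG (v : ℝ) : ℝ :=
  2 * (Real.exp (-(1 * v)) + Real.exp (-(3 * v)) / 3 + Real.exp (-(5 * v)) / 5 + Real.exp (-(7 * v)) / 7)

noncomputable def KK (v : ℝ) : ℝ :=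
  2 * ((1 - Real.exp (-(1 * v))) + (1 - Real.exp (-(3 * v))) / 9 + (1 - Real.exp (-(5 * v))) / 25
    + (1 - Real.exp (-(7 * v))) / 49)

lemma GG_nonneg (v : ℝ) : 0 ≤ GG v := by unfold GG; positivity

lemma GG_anti {a b : ℝ} (h : a ≤ b) : GG b ≤ GG a := by
  unfold GG
  gcongr

lemma GG_cont : Continuous GG := by unfold GG; fun_prop

lemma hasDerivAt_expm (m v : ℝ) : HasDerivAt (fun v => Real.exp (-(m * v))) (-m * Real.exp (-(m * v))) v := by
  have h0 : HasDerivAt (fun v : ℝ => -(m * v)) (-(m * 1)) v := ((hasDerivAt_id v).const_mul m).neg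
  exact h0.exp.congr_deriv (by ring)

lemma KK_deriv (v : ℝ) : HasDerivAt KK (GG v) v := by
  unfold KK GG
  have := ((((hasDerivAt_expm 1 v).const_sub 1).add (((hasDerivAt_expm 3 v).const_sub 1).div_const 9)).add
    (((hasDerivAt_expm 5 v).const_sub 1).div_const 25)).add (((hasDerivAt_expm 7 v).const_sub 1).div_const 49)
  refine (this.const_mul 2).congr_deriv ?_
  ring

lemma trap0 (t : ℝ) (ht : 0 ≤ t) : 1 - Real.exp (-t) ≤ t / 2 * (1 + Real.exp (-t)) := by
  have hd : ∀ t : ℝ, HasDerivAt (fun t => t / 2 * (1 + Real.exp (-t)) - 1 + Real.exp (-t))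
      (1 / 2 * (1 - (1 + t) * Real.exp (-t))) t := by
    intro t
    have e1 : HasDerivAt (fun t : ℝ => Real.exp (-t)) (-Real.exp (-t)) t := by
      simpa using hasDerivAt_expm 1 t
    have := ((((hasDerivAt_id t).div_const 2).mul (e1.const_add 1)).sub_const 1).add e1
    refine this.congr_deriv ?_
    simp only [id]
    ring
  have hm : MonotoneOn (fun t => t / 2 * (1 + Real.exp (-t)) - 1 + Real.exp (-t)) (Set.Ici 0) := by
    refine monotoneOn_of_deriv_nonneg (convex_Ici 0) (fun t _ => (hd t).continuousAt.continuousWithinAt)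
      (fun t _ => (hd t).differentiableAt.differentiableWithinAt) (fun t ht => ?_)
    rw [(hd t).deriv]
    have h1 := Real.add_one_le_exp t
    have h2 : Real.exp t * Real.exp (-t) = 1 := by rw [← Real.exp_add]; simp
    nlinarith [Real.exp_pos (-t)]
  have := hm (Set.mem_Ici.2 le_rfl) (Set.mem_Ici.2 ht) ht
  simp at this
  linarith

lemma trap1 (m a b : ℝ) (hm : 0 < m) (h : a ≤ b) :
    (Real.exp (-(m * a)) - Real.exp (-(m * b))) / m ≤
      (b - a) / 2 * (Real.exp (-(m * a)) + Real.exp (-(m * b))) := by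
  have h0 := trap0 (m * (b - a)) (mul_nonneg hm.le (by linarith))
  have e : Real.exp (-(m * b)) = Real.exp (-(m * a)) * Real.exp (-(m * (b - a))) := by
    rw [← Real.exp_add]; congr 1; ring
  rw [e, div_le_iff₀ hm]
  have := Real.exp_pos (-(m * a))
  nlinarith

lemma KK_trap {a b : ℝ} (h : a ≤ b) : KK b - KK a ≤ (b - a) / 2 * (GG a + GG b) := by
  have h1 := trap1 1 a b (by norm_num) h
  have h3 := trap1 3 a b (by norm_num) h
  have h5 := trap1 5 a b (by norm_num) h
  have h7 := trap1 7 a b (by norm_num) h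
  unfold KK GG
  linarith

lemma KK_zero : KK 0 = 0 := by simp [KK]

lemma KK_le {v : ℝ} (hv : 0 ≤ v) : KK v ≤ v * GG v + v := by
  have hg : ∀ v, HasDerivAt GG (-2 * (Real.exp (-(1 * v)) + Real.exp (-(3 * v)) + Real.exp (-(5 * v)) +
      Real.exp (-(7 * v)))) v := by
    intro v
    unfold GG
    have := (((hasDerivAt_expm 1 v).add ((hasDerivAt_expm 3 v).div_const 3)).add
      ((hasDerivAt_expm 5 v).div_const 5)).add ((hasDerivAt_expm 7 v).div_const 7)
    refine (this.const_mul 2).congr_deriv ?_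
    ring
  have hd : ∀ v : ℝ, HasDerivAt (fun v => v * GG v + v - KK v)
      (1 - 2 * v * (Real.exp (-(1 * v)) + Real.exp (-(3 * v)) + Real.exp (-(5 * v)) +
      Real.exp (-(7 * v)))) v := by
    intro t
    have := (((hasDerivAt_id t).mul (hg t)).add (hasDerivAt_id t)).sub (KK_deriv t)
    refine this.congr_deriv ?_
    simp only [id]
    ring
  have hm : MonotoneOn (fun v => v * GG v + v - KK v) (Set.Ici 0) := by
    refine monotoneOn_of_deriv_nonneg (convex_Ici 0) (fun t _ => (hd t).continuousAt.continuousWithinAt)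
      (fun t _ => (hd t).differentiableAt.differentiableWithinAt) (fun t ht => ?_)
    rw [(hd t).deriv]
    have ht0 : 0 ≤ t := by
      rw [interior_Ici] at ht; exact le_of_lt ht
    have hs : t ≤ Real.sinh t := Real.self_le_sinh_iff.2 ht0
    rw [Real.sinh_eq] at hs
    have h2 : Real.exp t * Real.exp (-t) = 1 := by rw [← Real.exp_add]; simp
    have q : ∀ n : ℕ, Real.exp (-((n : ℝ) * t)) = Real.exp (-t) ^ n := by
      intro n; rw [← Real.exp_nat_mul]; congr 1; ring
    have q1 := q 1
    have q3 := q 3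
    have q5 := q 5
    have q7 := q 7
    push_cast at q1 q3 q5 q7
    rw [q1, q3, q5, q7]
    set p := Real.exp (-t)
    have hp : 0 < p := Real.exp_pos _
    have hS : 0 < p ^ 1 + p ^ 3 + p ^ 5 + p ^ 7 := by positivity
    have : 2 * t * (p ^ 1 + p ^ 3 + p ^ 5 + p ^ 7) ≤ (Real.exp t - p) * (p ^ 1 + p ^ 3 + p ^ 5 + p ^ 7) :=
      mul_le_mul_of_nonneg_right (by linarith) hS.le
    have e : (Real.exp t - p) * (p ^ 1 + p ^ 3 + p ^ 5 + p ^ 7) = 1 - p ^ 8 := by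
      linear_combination (1 + p ^ 2 + p ^ 4 + p ^ 6) * h2
    have : 0 < p ^ 8 := by positivity
    linarith
  have := hm (Set.mem_Ici.2 le_rfl) (Set.mem_Ici.2 hv) hv
  simp only [KK_zero] at this
  linarith

lemma int_right (σ a b : ℝ) (hσ : σ ≤ a) (hab : a ≤ b) :
    ∫ v in a..b, GG |σ - v| = KK (b - σ) - KK (a - σ) := by
  have h1 : ∫ v in a..b, GG |σ - v| = ∫ v in a..b, GG (v - σ) := by
    refine intervalIntegral.integral_congr fun v hv => ?_
    rw [Set.uIcc_of_le hab] at hv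
    show GG |σ - v| = _
    rw [abs_sub_comm, abs_of_nonneg (by linarith [hv.1])]
  rw [h1]
  refine intervalIntegral.integral_eq_sub_of_hasDerivAt (f := fun v => KK (v - σ)) (fun v _ => ?_) ?_
  · exact (KK_deriv (v - σ)).comp_sub_const v σ
  · exact (GG_cont.comp (by fun_prop)).intervalIntegrable _ _

lemma int_left (σ a b : ℝ) (hσ : b ≤ σ) (hab : a ≤ b) :
    ∫ v in a..b, GG |σ - v| = KK (σ - a) - KK (σ - b) := by
  have h1 : ∫ v in a..b, GG |σ - v| = ∫ v in a..b, GG (σ - v) := by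
    refine intervalIntegral.integral_congr fun v hv => ?_
    rw [Set.uIcc_of_le hab] at hv
    show GG |σ - v| = _
    rw [abs_of_nonneg (by linarith [hv.2])]
  rw [h1]
  have := intervalIntegral.integral_eq_sub_of_hasDerivAt (a := a) (b := b) (f := fun v => - KK (σ - v)) (f' := fun v => GG (σ - v)) (fun v _ => ?_) ?_
  · rw [this]; ring
  · exact ((KK_deriv (σ - v)).comp_const_sub σ v).neg.congr_deriv (by ring)
  · exact (GG_cont.comp (by fun_prop)).intervalIntegrable _ _

lemma GGabs_cont (σ : ℝ) : Continuous fun v : ℝ => GG |σ - v| := GG_cont.comp (by fun_prop)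

lemma cell0 (σ a b : ℝ) (hab : a < b) :
    ∫ v in a..b, GG |σ - v| ≤ (b - a) / 2 * (GG |σ - a| + GG |σ - b|) +
      (b - a) * (if a < σ ∧ σ < b then 1 else 0) := by
  by_cases h1 : σ ≤ a
  · rw [if_neg (by intro h; linarith [h.1]), int_right σ a b h1 hab.le, abs_sub_comm, abs_sub_comm σ b,
      abs_of_nonneg (by linarith), abs_of_nonneg (by linarith)]
    have := KK_trap (a := a - σ) (b := b - σ) (by linarith)
    have e : b - σ - (a - σ) = b - a := by ring
    rw [e] at this
    linarith
  by_cases h2 : b ≤ σ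
  · rw [if_neg (by intro h; linarith [h.2]), int_left σ a b h2 hab.le,
      abs_of_nonneg (by linarith), abs_of_nonneg (by linarith)]
    have := KK_trap (a := σ - b) (b := σ - a) (by linarith)
    have e : σ - a - (σ - b) = b - a := by ring
    rw [e] at this
    linarith
  push Not at h1 h2
  rw [if_pos ⟨h1, h2⟩, ← intervalIntegral.integral_add_adjacent_intervals (b := σ)
    ((GGabs_cont σ).intervalIntegrable _ _) ((GGabs_cont σ).intervalIntegrable _ _),
    int_left σ a σ le_rfl h1.le, int_right σ σ b le_rfl h2.le, sub_self, KK_zero,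
    abs_of_nonneg (by linarith : (0:ℝ) ≤ σ - a), abs_sub_comm σ b, abs_of_nonneg (by linarith : (0:ℝ) ≤ b - σ)]
  have k1 := KK_le (v := σ - a) (by linarith)
  have k2 := KK_le (v := b - σ) (by linarith)
  have ch : ((σ - a) - (b - σ)) * (GG (σ - a) - GG (b - σ)) ≤ 0 := by
    rcases le_total (σ - a) (b - σ) with h | h
    · have := GG_anti h
      exact mul_nonpos_of_nonpos_of_nonneg (by linarith) (by linarith)
    · have := GG_anti h
      exact mul_nonpos_of_nonneg_of_nonpos (by linarith) (by linarith)
  nlinarith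

lemma cell1 (σ a b : ℝ) (hab : a < b) (w : ℝ → ℝ) (hw : Continuous w)
    (hwle : ∀ v, a ≤ v → v ≤ b → w v * (b - a) ≤ 1) :
    ∫ v in a..b, GG |σ - v| * w v ≤ 1 / 2 * (GG |σ - a| + GG |σ - b|) +
      (if a < σ ∧ σ < b then 1 else 0) := by
  have hl : 0 < b - a := by linarith
  have h1 : ∫ v in a..b, GG |σ - v| * w v ≤ ∫ v in a..b, GG |σ - v| * (1 / (b - a)) := by
    refine intervalIntegral.integral_mono_on hab.le
      (((GGabs_cont σ).mul hw).intervalIntegrable _ _)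
      (((GGabs_cont σ).mul continuous_const).intervalIntegrable _ _) fun v hv => ?_
    refine mul_le_mul_of_nonneg_left ?_ (GG_nonneg _)
    rw [le_div_iff₀ hl]
    exact hwle v hv.1 hv.2
  refine h1.trans ?_
  rw [intervalIntegral.integral_mul_const, mul_one_div, div_le_iff₀ hl]
  refine (cell0 σ a b hab).trans (le_of_eq ?_)
  ring

/-- sum over all nodes -/
lemma cells (σ : ℝ) (hσ : 0 ≤ σ) (w : ℝ → ℝ) (hw : Continuous w) (y : ℕ → ℝ) (n : ℕ) (hy0 : 0 < y 0)
    (hmono : ∀ i < n, y i < y (i + 1))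
    (hc : ∀ v, |v| ≤ y 0 → w v * (2 * y 0) ≤ 1)
    (hcell : ∀ i < n, ∀ v, y i ≤ |v| → w v * (y (i + 1) - y i) ≤ 1) :
    0 < y n ∧ ∫ v in (-(y n))..(y n), GG |σ - v| * w v ≤
      ∑ i ∈ Finset.range (n + 1), (GG |σ - y i| + GG |σ + y i|) - 1 / 2 * (GG |σ - y n| + GG |σ + y n|)
       + (if σ < y n then 1 else 0) := by
  induction n with
  | zero =>
    refine ⟨hy0, ?_⟩
    have := cell1 σ (-(y 0)) (y 0) (by linarith) w hw (fun v h1 h2 => by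
      have := hc v (abs_le.2 ⟨h1, h2⟩)
      linarith)
    simp only [zero_add, Finset.sum_range_one]
    rw [sub_neg_eq_add] at this
    have e : (if -(y 0) < σ ∧ σ < y 0 then (1:ℝ) else 0) = if σ < y 0 then 1 else 0 := by
      congr 1
      simp only [eq_iff_iff, and_iff_right_iff_imp]
      intro _; linarith
    rw [e] at this
    linarith
  | succ n ih =>
    obtain ⟨hp, ih⟩ := ih (fun i hi => hmono i (by omega)) (fun i hi => hcell i (by omega))
    have hm := hmono n (by omega)
    refine ⟨hp.trans hm, ?_⟩
    have hi : ∀ a b : ℝ, IntervalIntegrable (fun v => GG |σ - v| * w v) MeasureTheory.volume a b :=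
      fun a b => ((GGabs_cont σ).mul hw).intervalIntegrable _ _
    rw [← intervalIntegral.integral_add_adjacent_intervals (hi _ (-(y n))) (hi _ _),
      ← intervalIntegral.integral_add_adjacent_intervals (hi (-(y n)) (y n)) (hi _ _)]
    have c1 := cell1 σ (-(y (n + 1))) (-(y n)) (by linarith) w hw (fun v h1 h2 => by
      have := hcell n (by omega) v (by rw [abs_of_neg (by linarith)]; linarith)
      linarith)
    have c2 := cell1 σ (y n) (y (n + 1)) hm w hw (fun v h1 h2 =>
      hcell n (by omega) v (by rw [abs_of_pos (by linarith)]; linarith))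
    rw [if_neg (by intro h; linarith [h.2]), sub_neg_eq_add, sub_neg_eq_add] at c1
    rw [Finset.sum_range_succ]
    have e : (if y n < σ ∧ σ < y (n + 1) then (1:ℝ) else 0) + (if σ < y n then 1 else 0) ≤
        if σ < y (n + 1) then 1 else 0 := by
      by_cases h : σ < y n
      · rw [if_neg (by intro h'; linarith [h'.1]), if_pos h, if_pos (by linarith)]; norm_num
      · rw [if_neg h]
        by_cases h' : σ < y (n + 1)
        · rw [if_pos h']; split_ifs <;> norm_num
        · rw [if_neg h', if_neg (by tauto)]; norm_num
    linarith

lemma int_exp_low (m A T σ : ℝ) (hm : 0 < m) (hσ : 0 ≤ σ) (hσA : σ ≤ A) (hTA : T ≤ A) :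
    2 * (T - σ) / m - 2 * Real.exp (-(m * σ)) / m ^ 2 ≤
      ∫ v in (-A)..A, Real.exp (-(m * |σ - v|)) * (T - |v|) := by
  have hi : ∀ a b : ℝ, IntervalIntegrable (fun v => Real.exp (-(m * |σ - v|)) * (T - |v|))
      MeasureTheory.volume a b :=
    fun a b => (Continuous.intervalIntegrable (by fun_prop) _ _)
  rw [← intervalIntegral.integral_add_adjacent_intervals (hi (-A) 0) (hi _ _),
    ← intervalIntegral.integral_add_adjacent_intervals (hi 0 σ) (hi _ _)]
  have hm' := hm.ne'
  have dr : ∀ c v : ℝ, HasDerivAt (fun v => Real.exp (-(m * (v - c)))) (-m * Real.exp (-(m * (v - c)))) v :=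
    fun c v => (hasDerivAt_expm m (v - c)).comp_sub_const v c
  have dl : ∀ c v : ℝ, HasDerivAt (fun v => Real.exp (-(m * (c - v)))) (m * Real.exp (-(m * (c - v)))) v :=
    fun c v => ((hasDerivAt_expm m (c - v)).comp_const_sub c v).congr_deriv (by ring)
  have i1 : ∫ v in (-A)..0, Real.exp (-(m * |σ - v|)) * (T - |v|) =
      Real.exp (-(m * σ)) * (T / m - 1 / m ^ 2)
      - Real.exp (-(m * (σ + A))) * ((T - A) / m - 1 / m ^ 2) := by
    have h1 : ∫ v in (-A)..0, Real.exp (-(m * |σ - v|)) * (T - |v|) =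
        ∫ v in (-A)..0, Real.exp (-(m * (σ - v))) * (T + v) := by
      refine intervalIntegral.integral_congr fun v hv => ?_
      rw [Set.uIcc_of_le (by linarith)] at hv
      show Real.exp (-(m * |σ - v|)) * (T - |v|) = _
      rw [abs_of_nonneg (by linarith [hv.2] : 0 ≤ σ - v), abs_of_nonpos hv.2, sub_neg_eq_add]
    rw [h1, intervalIntegral.integral_eq_sub_of_hasDerivAt
      (f := fun v => Real.exp (-(m * (σ - v))) * ((T + v) / m - 1 / m ^ 2)) (fun v _ => ?_)
      (Continuous.intervalIntegrable (by fun_prop) _ _)]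
    · simp only [sub_zero, add_zero, sub_neg_eq_add]; rw [← sub_eq_add_neg]
    · refine ((dl σ v).mul ((((hasDerivAt_id v).const_add T).div_const m).sub_const (1 / m ^ 2))).congr_deriv ?_
      simp only [id]
      field_simp
      ring
  have i2 : ∫ v in (0)..σ, Real.exp (-(m * |σ - v|)) * (T - |v|) =
      ((T - σ) / m + 1 / m ^ 2) - Real.exp (-(m * σ)) * (T / m + 1 / m ^ 2) := by
    have h1 : ∫ v in (0)..σ, Real.exp (-(m * |σ - v|)) * (T - |v|) =
        ∫ v in (0)..σ, Real.exp (-(m * (σ - v))) * (T - v) := by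
      refine intervalIntegral.integral_congr fun v hv => ?_
      rw [Set.uIcc_of_le (by linarith)] at hv
      show Real.exp (-(m * |σ - v|)) * (T - |v|) = _
      rw [abs_of_nonneg (by linarith [hv.2] : 0 ≤ σ - v), abs_of_nonneg hv.1]
    rw [h1, intervalIntegral.integral_eq_sub_of_hasDerivAt
      (f := fun v => Real.exp (-(m * (σ - v))) * ((T - v) / m + 1 / m ^ 2)) (fun v _ => ?_)
      (Continuous.intervalIntegrable (by fun_prop) _ _)]
    · simp
    · refine ((dl σ v).mul ((((hasDerivAt_id v).const_sub T).div_const m).add_const (1 / m ^ 2))).congr_deriv ?_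
      simp only [id]
      field_simp
      ring
  have i3 : ∫ v in σ..A, Real.exp (-(m * |σ - v|)) * (T - |v|) =
      Real.exp (-(m * (A - σ))) * (1 / m ^ 2 - (T - A) / m) - (1 / m ^ 2 - (T - σ) / m) := by
    have h1 : ∫ v in σ..A, Real.exp (-(m * |σ - v|)) * (T - |v|) =
        ∫ v in σ..A, Real.exp (-(m * (v - σ))) * (T - v) := by
      refine intervalIntegral.integral_congr fun v hv => ?_
      rw [Set.uIcc_of_le (by linarith)] at hv
      show Real.exp (-(m * |σ - v|)) * (T - |v|) = _
      rw [abs_sub_comm, abs_of_nonneg (by linarith [hv.1] : 0 ≤ v - σ), abs_of_nonneg (hσ.trans hv.1)]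
    rw [h1, intervalIntegral.integral_eq_sub_of_hasDerivAt
      (f := fun v => Real.exp (-(m * (v - σ))) * (1 / m ^ 2 - (T - v) / m)) (fun v _ => ?_)
      (Continuous.intervalIntegrable (by fun_prop) _ _)]
    · simp
    · refine ((dr σ v).mul ((((hasDerivAt_id v).const_sub T).div_const m).const_sub (1 / m ^ 2))).congr_deriv ?_
      simp only [id]
      field_simp
      ring
  rw [i1, i2, i3]
  have hp : 0 ≤ 1 / m ^ 2 - (T - A) / m := by
    have : (T - A) / m ≤ 0 := div_nonpos_of_nonpos_of_nonneg (by linarith) hm.le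
    have : 0 < 1 / m ^ 2 := by positivity
    linarith
  have p1 := mul_nonneg (Real.exp_pos (-(m * (A - σ)))).le hp
  have p2 := mul_nonneg (Real.exp_pos (-(m * (σ + A)))).le hp
  have e1 : 2 * (T - σ) / m = (T - σ) / m + (T - σ) / m := by ring
  have e2 : 2 * Real.exp (-(m * σ)) / m ^ 2 = 2 * (Real.exp (-(m * σ)) * (1 / m ^ 2)) := by ring
  rw [e1, e2]
  nlinarith

noncomputable def kap : ℝ := 11025 / 129160

lemma int_GG_low (A T σ : ℝ) (hσ : 0 ≤ σ) (hσA : σ ≤ A) (hTA : T ≤ A) :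
    4 / 10 * (T - σ) - 0.3579 * Real.exp (-σ) ≤
      ∫ v in (-A)..A, GG |σ - v| * (kap * (T - |v|)) := by
  have k1 := int_exp_low 1 A T σ (by norm_num) hσ hσA hTA
  have k3 := int_exp_low 3 A T σ (by norm_num) hσ hσA hTA
  have k5 := int_exp_low 5 A T σ (by norm_num) hσ hσA hTA
  have k7 := int_exp_low 7 A T σ (by norm_num) hσ hσA hTA
  have hi : ∀ m : ℝ, IntervalIntegrable (fun v => Real.exp (-(m * |σ - v|)) * (T - |v|))
      MeasureTheory.volume (-A) A :=
    fun m => (Continuous.intervalIntegrable (by fun_prop) _ _)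
  have e : ∫ v in (-A)..A, GG |σ - v| * (kap * (T - |v|)) =
      (2 * kap) * (((∫ v in (-A)..A, Real.exp (-(1 * |σ - v|)) * (T - |v|)) +
      (1/3) * (∫ v in (-A)..A, Real.exp (-(3 * |σ - v|)) * (T - |v|))) +
      (1/5) * (∫ v in (-A)..A, Real.exp (-(5 * |σ - v|)) * (T - |v|)) +
      (1/7) * (∫ v in (-A)..A, Real.exp (-(7 * |σ - v|)) * (T - |v|))) := by
    rw [← intervalIntegral.integral_const_mul, ← intervalIntegral.integral_const_mul,
      ← intervalIntegral.integral_const_mul, ← intervalIntegral.integral_add (hi 1) ((hi 3).const_mul _),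
      ← intervalIntegral.integral_add ((hi 1).add ((hi 3).const_mul _)) ((hi 5).const_mul _),
      ← intervalIntegral.integral_add (((hi 1).add ((hi 3).const_mul _)).add ((hi 5).const_mul _))
        ((hi 7).const_mul _), ← intervalIntegral.integral_const_mul]
    refine intervalIntegral.integral_congr fun v hv => ?_
    simp only [GG]
    ring
  rw [e]
  have hq : ∀ m : ℝ, 1 ≤ m → Real.exp (-(m * σ)) ≤ Real.exp (-σ) := by
    intro m h
    refine Real.exp_le_exp.2 ?_
    nlinarith
  have q1 := hq 1 le_rfl
  have q3 := hq 3 (by norm_num)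
  have q5 := hq 5 (by norm_num)
  have q7 := hq 7 (by norm_num)
  have := Real.exp_pos (-σ)
  unfold kap
  simp only [one_mul] at k1 ⊢
  norm_num at k1 k3 k5 k7 ⊢
  linarith

lemma tanh_GG (v : ℝ) (hv : 0 ≤ v) : 1 - Real.exp (-v) ≤ (1 + Real.exp (-v)) * Real.exp (-GG v) := by
  set q := Real.exp (-v) with hq
  have q0 : 0 < q := Real.exp_pos _
  rcases hv.eq_or_lt with h | h
  · have : q = 1 := by rw [hq, ← h]; simp
    rw [this, sub_self]; positivity
  have q1 : q < 1 := by rw [hq]; rw [Real.exp_lt_one_iff]; linarith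
  have hs := Real.hasSum_log_sub_log_of_abs_lt_one (x := q) (by rw [abs_of_pos q0]; exact q1)
  have h4 := sum_le_hasSum (Finset.range 4) (fun i _ => by positivity) hs
  have hG : GG v = ∑ i ∈ Finset.range 4, (2:ℝ) * (1 / (2 * (i:ℝ) + 1)) * q ^ (2 * i + 1) := by
    have qq : ∀ n : ℕ, Real.exp (-((n : ℝ) * v)) = q ^ n := by
      intro n; rw [hq, ← Real.exp_nat_mul]; congr 1; ring
    have e1 := qq 1
    have e3 := qq 3
    have e5 := qq 5
    have e7 := qq 7
    push_cast at e1 e3 e5 e7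
    simp only [GG, Finset.sum_range_succ, Finset.sum_range_zero]
    rw [e1, e3, e5, e7]
    push_cast
    ring
  rw [← hG] at h4
  have : Real.exp (-GG v) ≥ (1 - q) / (1 + q) := by
    rw [ge_iff_le, ← Real.log_le_iff_le_exp (by apply div_pos <;> linarith), Real.log_div (by linarith) (by linarith)]
    linarith
  rw [ge_iff_le, div_le_iff₀ (by linarith)] at this
  linarith

lemma cosh_fac (σ y : ℝ) : Real.cosh σ - Real.cosh y = Real.exp σ / 2 * ((1 - Real.exp (-(σ - y))) * (1 - Real.exp (-(σ + y))))
    ∧ Real.cosh σ + Real.cosh y = Real.exp σ / 2 * ((1 + Real.exp (-(σ - y))) * (1 + Real.exp (-(σ + y)))) := by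
  have a : Real.exp σ ≠ 0 := (Real.exp_pos _).ne'
  have b : Real.exp y ≠ 0 := (Real.exp_pos _).ne'
  have e1 : Real.exp (-(σ - y)) = Real.exp y / Real.exp σ := by rw [← Real.exp_sub]; congr 1; ring
  have e2 : Real.exp (-(σ + y)) = 1 / (Real.exp y * Real.exp σ) := by
    rw [Real.exp_neg, Real.exp_add]; field_simp
  rw [e1, e2, Real.cosh_eq, Real.cosh_eq, Real.exp_neg, Real.exp_neg]
  constructor <;> field_simp <;> ring

lemma node_bd0 (σ y : ℝ) (hσ : 0 ≤ σ) (hy : 0 ≤ y) (h : y ≤ σ) :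
    |Real.cosh σ - Real.cosh y| ≤ (Real.cosh σ + Real.cosh y) * Real.exp (-(GG |σ - y| + GG |σ + y|)) := by
  obtain ⟨e1, e2⟩ := cosh_fac σ y
  rw [e1, e2, abs_of_nonneg (by linarith : 0 ≤ σ - y), abs_of_nonneg (by linarith : 0 ≤ σ + y)]
  have t1 := tanh_GG (σ - y) (by linarith)
  have t2 := tanh_GG (σ + y) (by linarith)
  have p1 : 0 ≤ 1 - Real.exp (-(σ - y)) := by
    have : Real.exp (-(σ - y)) ≤ 1 := Real.exp_le_one_iff.2 (by linarith)
    linarith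
  have p2 : 0 ≤ 1 - Real.exp (-(σ + y)) := by
    have : Real.exp (-(σ + y)) ≤ 1 := Real.exp_le_one_iff.2 (by linarith)
    linarith
  rw [abs_of_nonneg (by positivity), neg_add (GG (σ - y)), Real.exp_add (-GG (σ - y))]
  have := mul_le_mul t1 t2 p2 (by positivity)
  have h3 : 0 ≤ Real.exp σ / 2 := by positivity
  have := mul_le_mul_of_nonneg_left this h3
  refine this.trans (le_of_eq ?_)
  ring

lemma node_bd (σ y : ℝ) (hσ : 0 ≤ σ) (hy : 0 ≤ y) :
    ((Real.cosh σ - Real.cosh y) / (Real.cosh σ + Real.cosh y)) ^ 2 ≤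
      Real.exp (-(2 * (GG |σ - y| + GG |σ + y|))) := by
  have hp : 0 < Real.cosh σ + Real.cosh y := by
    have := Real.cosh_pos σ; have := Real.cosh_pos y; linarith
  have h : |Real.cosh σ - Real.cosh y| ≤ (Real.cosh σ + Real.cosh y) * Real.exp (-(GG |σ - y| + GG |σ + y|)) := by
    rcases le_total y σ with h | h
    · exact node_bd0 σ y hσ hy h
    · have := node_bd0 y σ hy hσ h
      rw [abs_sub_comm, abs_sub_comm σ y, add_comm σ y, add_comm (Real.cosh σ)]
      exact this
  have e : Real.exp (-(2 * (GG |σ - y| + GG |σ + y|))) = Real.exp (-(GG |σ - y| + GG |σ + y|)) ^ 2 := by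
    rw [← Real.exp_nat_mul]; congr 1; push_cast; ring
  rw [e, ← sq_abs, abs_div, abs_of_pos hp]
  gcongr
  rw [div_le_iff₀ hp]
  linarith

noncomputable def nds (r i : ℕ) : ℝ :=
  √((2 * (r : ℝ) - 1) / kap) - √(2 * ((r : ℝ) - 1 - i) / kap)

lemma kap_pos : 0 < kap := by unfold kap; norm_num

lemma nds_mono {r i j : ℕ} (hij : i < j) (hj : j < r) : nds r i < nds r j := by
  unfold nds
  have hj' : (j : ℝ) + 1 ≤ r := by exact_mod_cast hj
  have hij' : (i : ℝ) < j := by exact_mod_cast hij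
  have hk := kap_pos
  have : √(2 * ((r : ℝ) - 1 - j) / kap) < √(2 * ((r : ℝ) - 1 - i) / kap) := by
    refine Real.sqrt_lt_sqrt (div_nonneg (by linarith) hk.le) ?_
    exact div_lt_div_of_pos_right (by linarith) hk
  linarith

lemma nds_zero_pos {r : ℕ} (hr : 1 ≤ r) : 0 < nds r 0 := by
  unfold nds
  have hr' : (1 : ℝ) ≤ r := by exact_mod_cast hr
  have hk := kap_pos
  have : √(2 * ((r : ℝ) - 1 - (0 : ℕ)) / kap) < √((2 * (r : ℝ) - 1) / kap) := by
    refine Real.sqrt_lt_sqrt (div_nonneg (by push_cast; linarith) hk.le) ?_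
    exact div_lt_div_of_pos_right (by push_cast; linarith) hk
  linarith

lemma nds_pos {r i : ℕ} (hi : i < r) : 0 < nds r i := by
  rcases Nat.eq_zero_or_pos i with h | h
  · subst h; exact nds_zero_pos hi
  · exact (nds_zero_pos (by omega)).trans (nds_mono h hi)

/-- `√A - √B ≤ √D` when `A ≤ B + D`. -/
lemma sqrt_sub_le' (A B D : ℝ) (hB : 0 ≤ B) (hD : 0 ≤ D) (h : A ≤ B + D) : √A - √B ≤ √D := by
  have := Real.sqrt_le_sqrt h
  have h2 : √(B + D) ≤ √B + √D := by
    refine Real.sqrt_le_iff.2 ⟨by positivity, ?_⟩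
    have := Real.sq_sqrt hB
    have := Real.sq_sqrt hD
    nlinarith [mul_nonneg (Real.sqrt_nonneg B) (Real.sqrt_nonneg D)]
  linarith

lemma sum_low {r : ℕ} (hr : 1 ≤ r) (σ : ℝ) (hσ : 0 ≤ σ)
    (hσA : σ ≤ √((2 * (r : ℝ) - 1) / kap)) :
    4 / 10 * (√((2 * (r : ℝ) - 1) / kap) - √(2 / kap) / 2 - σ) - 0.3579 * Real.exp (-σ) - 1 ≤
      ∑ i ∈ Finset.range r, (GG |σ - nds r i| + GG |σ + nds r i|) := by
  obtain ⟨n, rfl⟩ : ∃ n, r = n + 1 := ⟨r - 1, by omega⟩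
  set A := √((2 * ((n + 1 : ℕ) : ℝ) - 1) / kap) with hA
  set d := √(2 / kap) with hd
  have hk := kap_pos
  have d0 : 0 ≤ d := Real.sqrt_nonneg _
  have hlast : nds (n + 1) n = A := by
    unfold nds
    push_cast
    simp [hA]
  have n0 : (0:ℝ) ≤ n := Nat.cast_nonneg n
  have hc := cells σ hσ (fun v => kap * (A - d / 2 - |v|)) (by fun_prop) (nds (n + 1)) n
    (nds_zero_pos (by omega)) (fun i hi => nds_mono (by omega) (by omega)) ?_ ?_
  · rw [hlast] at hc
    have hlow := int_GG_low A (A - d / 2) σ hσ hσA (by linarith)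
    have g1 := GG_nonneg |σ - A|
    have g2 := GG_nonneg |σ + A|
    have : (if σ < A then (1:ℝ) else 0) ≤ 1 := by split_ifs <;> norm_num
    linarith [hc.2]
  · intro v _
    set P := √(2 * (((n + 1 : ℕ) : ℝ) - 1 - (0 : ℕ)) / kap) with hP
    have e0 : nds (n + 1) 0 = A - P := rfl
    rw [e0]
    have hA2 : A ^ 2 = (2 * ((n + 1 : ℕ) : ℝ) - 1) / kap :=
      Real.sq_sqrt (div_nonneg (by push_cast; linarith) hk.le)
    have hP2 : P ^ 2 = 2 * (((n + 1 : ℕ) : ℝ) - 1 - (0 : ℕ)) / kap :=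
      Real.sq_sqrt (div_nonneg (by push_cast; linarith) hk.le)
    have hAP : kap * (A ^ 2 - P ^ 2) = 1 := by
      rw [hA2, hP2]; push_cast; field_simp; ring
    have hle : A - P ≤ d := by
      refine sqrt_sub_le' _ _ _ (div_nonneg (by push_cast; linarith) hk.le) (by positivity) ?_
      rw [← add_div]
      exact div_le_div_of_nonneg_right (by push_cast; linarith) hk.le
    have hpos : 0 < A - P := by rw [← e0]; exact nds_zero_pos (by omega)
    have hv := abs_nonneg v
    have h1 : A - d / 2 - |v| ≤ (A + P) / 2 := by linarith
    have : kap * (A - d / 2 - |v|) * (2 * (A - P)) ≤ kap * ((A + P) / 2) * (2 * (A - P)) := by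
      gcongr
    refine this.trans (le_of_eq ?_)
    rw [← hAP]; ring
  · intro i hi v hv
    have hi' : (i : ℝ) + 1 ≤ n := by exact_mod_cast hi
    have hpos : 0 < nds (n + 1) (i + 1) - nds (n + 1) i := by
      have := nds_mono (r := n + 1) (i := i) (j := i + 1) (by omega) (by omega)
      linarith
    set P := √(2 * (((n + 1 : ℕ) : ℝ) - 1 - i) / kap) with hP
    set Q := √(2 * (((n + 1 : ℕ) : ℝ) - 1 - ((i + 1 : ℕ) : ℝ)) / kap) with hQ
    have e0 : nds (n + 1) i = A - P := rfl
    have e1 : nds (n + 1) (i + 1) = A - Q := rfl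
    rw [e0, e1] at hpos
    rw [e0] at hv
    rw [e0, e1]
    have hP2 : P ^ 2 = 2 * (((n + 1 : ℕ) : ℝ) - 1 - i) / kap :=
      Real.sq_sqrt (div_nonneg (by push_cast; linarith) hk.le)
    have hQ2 : Q ^ 2 = 2 * (((n + 1 : ℕ) : ℝ) - 1 - ((i + 1 : ℕ) : ℝ)) / kap :=
      Real.sq_sqrt (div_nonneg (by push_cast; linarith) hk.le)
    have hPQ : kap * (P ^ 2 - Q ^ 2) = 2 := by
      rw [hP2, hQ2]; push_cast; field_simp; ring
    have hle : P - Q ≤ d := by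
      refine sqrt_sub_le' _ _ _ (div_nonneg (by push_cast; linarith) hk.le) (by positivity) ?_
      rw [← add_div]
      exact div_le_div_of_nonneg_right (by push_cast; linarith) hk.le
    have h1 : A - d / 2 - |v| ≤ (P + Q) / 2 := by linarith
    have e2 : A - Q - (A - P) = P - Q := by ring
    have hpos' : 0 < P - Q := by linarith
    rw [e2]
    have : kap * (A - d / 2 - |v|) * (P - Q) ≤ kap * ((P + Q) / 2) * (P - Q) := by
      gcongr
    refine this.trans (le_of_eq ?_)
    linear_combination (1 / 2) * hPQ

lemma log_half_low (q : ℝ) : -0.357 + 1 - 1.4 / (1 + q ^ 2) ≤ Real.log ((1 + q ^ 2) / 2) := by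
  have hq : 0 < 1 + q ^ 2 := by positivity
  have h7 : -0.357 ≤ Real.log (0.7 : ℝ) := by
    have e : Real.log ((0.7 : ℝ) ^ 2) = 2 * Real.log 0.7 := by rw [Real.log_pow]; norm_num
    have e2 : ((0.7 : ℝ) ^ 2) = 0.98 / 2 := by norm_num
    rw [e2, Real.log_div (by norm_num) (by norm_num)] at e
    have := Real.log_two_lt_d9
    have := Real.one_sub_inv_le_log_of_pos (x := (0.98 : ℝ)) (by norm_num)
    norm_num at *
    linarith
  have e : (1 + q ^ 2) / 2 = 0.7 * ((1 + q ^ 2) / 1.4) := by ring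
  have h := Real.one_sub_inv_le_log_of_pos (x := (1 + q ^ 2) / 1.4) (by positivity)
  rw [inv_div] at h
  rw [e, Real.log_mul (by norm_num) (by positivity)]
  linarith

lemma scal (q : ℝ) (h0 : 0 ≤ q) (h1 : q ≤ 1) : 0.7158 * q ≤ 0.812 + 0.8 * Real.log ((1 + q ^ 2) / 2) := by
  have h := log_half_low q
  have hq : 0 < 1 + q ^ 2 := by positivity
  have : 1.12 / (1 + q ^ 2) ≤ 1.3264 - 0.7158 * q := by
    rw [div_le_iff₀ hq]
    nlinarith [mul_nonneg h0 (sq_nonneg (q - 0.65)), sq_nonneg (q - 0.65), sq_nonneg (q - 0.3), mul_nonneg h0 (sub_nonneg.2 h1), mul_nonneg (sub_nonneg.2 h1) (sq_nonneg (q-0.3))]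
  have e : 1.12 / (1 + q ^ 2) = 0.8 * (1.4 / (1 + q ^ 2)) := by ring
  linarith

lemma T_low {r : ℕ} (hr : 25 ≤ r) :
    1.25 * (Real.pi * √(r : ℝ)) + 1.89 ≤ √((2 * (r : ℝ) - 1) / kap) - √(2 / kap) / 2 := by
  have hr' : (25 : ℝ) ≤ r := by exact_mod_cast hr
  have h5 : 5 ≤ √(r : ℝ) := Real.le_sqrt_of_sq_le (by norm_num; linarith)
  have hs : √(r : ℝ) ^ 2 = r := Real.sq_sqrt (by linarith)
  have h1 : 4.791 * √(r : ℝ) ≤ √((2 * (r : ℝ) - 1) / kap) := by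
    refine Real.le_sqrt_of_sq_le ?_
    rw [mul_pow, hs, le_div_iff₀ kap_pos]
    unfold kap
    norm_num
    linarith
  have h2 : √(2 / kap) ≤ 4.8406 := by
    refine Real.sqrt_le_iff.2 ⟨by norm_num, ?_⟩
    unfold kap
    norm_num
  have h3 := Real.pi_lt_d4
  have : Real.pi * √(r : ℝ) ≤ 3.1416 * √(r : ℝ) := by gcongr
  linarith

lemma const_low : 2 + √5 ≤ 16 * Real.exp (-1.3) := by
  have h5 : √5 ≤ 2.24 := Real.sqrt_le_iff.2 ⟨by norm_num, by norm_num⟩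
  have he : Real.exp 1.3 ≤ 3.7 := by
    refine le_of_pow_le_pow_left₀ (n := 10) (by norm_num) (by norm_num) ?_
    rw [← Real.exp_nat_mul]
    have : ((10 : ℕ) : ℝ) * 1.3 = (13 : ℕ) * 1 := by norm_num
    rw [this, Real.exp_nat_mul]
    refine (pow_le_pow_left₀ (Real.exp_nonneg _) Real.exp_one_lt_d9.le 13).trans ?_
    norm_num
  have hp := Real.exp_pos 1.3
  rw [Real.exp_neg, ← div_eq_mul_inv, le_div_iff₀ hp]
  nlinarith

lemma core_large {r : ℕ} (hr : 25 ≤ r) : Core r := by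
  have hr1 : 1 ≤ r := by omega
  set X : Fin r → ℝ := fun i => Real.cosh (nds r i) with hX
  have hXpos : ∀ i, 0 < X i := fun i => Real.cosh_pos _
  have hXinj : Function.Injective X := by
    have hlt : ∀ i j : Fin r, i < j → X i < X j := by
      intro i j hij
      refine Real.cosh_lt_cosh.2 ?_
      rw [abs_of_pos (nds_pos i.2), abs_of_pos (nds_pos j.2)]
      exact nds_mono hij j.2
    exact (StrictMono.injective fun i j h => hlt i j h)
  have hinj : Function.Injective fun i => (X i) ^ (4 / 5 : ℝ) := by
    intro i j h
    exact hXinj ((Real.rpow_left_inj (hXpos i).le (hXpos j).le (by norm_num)).1 h)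
  obtain ⟨ω, a, hω, ha, h0, h1, hle⟩ := interp_pos hr1 (fun i => (X i) ^ (4 / 5 : ℝ)) hinj
    (fun i => Real.rpow_pos_of_pos (hXpos i) _)
  refine ⟨ω, a, hω, ha, ?_, hle⟩
  intro x hx
  have x0 : 0 < x := by linarith
  have hlx := hle x x0
  rw [abs_of_nonneg (by linarith)]
  set s := Real.pi * √(r : ℝ) with hs
  have hSpos : 0 ≤ ∑ k, ω k * Real.exp (-(a k) * x) :=
    Finset.sum_nonneg fun k _ => mul_nonneg (hω k).le (Real.exp_pos _).le
  by_cases hxs : Real.exp s ≤ x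
  · have : 1 / x ≤ 1 / Real.exp s := one_div_le_one_div_of_le (Real.exp_pos _) hxs
    rw [Real.exp_neg, ← one_div]
    have : 0 < 1 / Real.exp s := by positivity
    linarith
  push Not at hxs
  set Y := x ^ (5 / 4 : ℝ) with hY
  have hY1 : 1 ≤ Y := Real.one_le_rpow hx (by norm_num)
  have hYx : Y ^ (4 / 5 : ℝ) = x := by
    rw [hY, ← Real.rpow_mul x0.le]; norm_num
  set σ := Real.arcosh Y with hσ
  have hσ0 : 0 ≤ σ := Real.arcosh_nonneg hY1
  have hcσ : Real.cosh σ = Y := Real.cosh_arcosh hY1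
  have hlogY : Real.log Y = 5 / 4 * Real.log x := Real.log_rpow x0 _
  set q := Real.exp (-σ) with hq
  have q0 : 0 < q := Real.exp_pos _
  have q1 : q ≤ 1 := Real.exp_le_one_iff.2 (by linarith)
  have hlogY2 : Real.log Y = σ + Real.log ((1 + q ^ 2) / 2) := by
    have e : Y = Real.exp σ * ((1 + q ^ 2) / 2) := by
      rw [← hcσ, Real.cosh_eq, ← hq]
      have : Real.exp σ * q = 1 := by rw [hq, ← Real.exp_add]; simp
      linear_combination (-(q / 2)) * this
    rw [e, Real.log_mul (Real.exp_pos _).ne' (by positivity), Real.log_exp]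
  have hsc := scal q q0.le q1
  have hT := T_low hr
  have hlx' : Real.log x ≤ s := by
    rw [Real.log_le_iff_le_exp x0]; exact hxs.le
  have hd : 0 ≤ √(2 / kap) := Real.sqrt_nonneg _
  have hσA : σ ≤ √((2 * (r : ℝ) - 1) / kap) := by
    linarith
  have hsum := sum_low hr1 σ hσ0 hσA
  have hlb := large_bound ω a hω X hXpos hXinj h0 h1 hle Y (by linarith)
  rw [hYx] at hlb
  have hprod : ∏ i, ((Y - X i) / (Y + X i)) ^ 2 ≤
      Real.exp (-(2 * ∑ i ∈ Finset.range r, (GG |σ - nds r i| + GG |σ + nds r i|))) := by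
    rw [← Fin.sum_univ_eq_sum_range (fun i => GG |σ - nds r i| + GG |σ + nds r i|), Finset.mul_sum,
      ← Finset.sum_neg_distrib, Real.exp_sum]
    refine Finset.prod_le_prod (fun i _ => sq_nonneg _) fun i _ => ?_
    rw [← hcσ]
    exact node_bd σ (nds r i) hσ0 (nds_pos i.2).le
  have hfin : (2 + √5) * ∏ i, ((Y - X i) / (Y + X i)) ^ 2 ≤ 16 * Real.exp (-s) * x := by
    have c5 : 0 ≤ 2 + √5 := by positivity
    refine (mul_le_mul const_low hprod (Finset.prod_nonneg fun i _ => sq_nonneg _) (by positivity)).trans ?_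
    have ex : 16 * Real.exp (-s) * x = 16 * Real.exp (-s) * Real.exp (Real.log x) := by rw [Real.exp_log x0]
    rw [ex, mul_assoc, mul_assoc, ← Real.exp_add, ← Real.exp_add]
    refine mul_le_mul_of_nonneg_left (Real.exp_le_exp.2 ?_) (by norm_num)
    rw [← hq] at hsum
    linarith
  have : (1 / x - ∑ k, ω k * Real.exp (-(a k) * x)) * x = 1 - x * ∑ k, ω k * Real.exp (-(a k) * x) := by
    field_simp
  refine le_of_mul_le_mul_right ?_ x0
  rw [this]
  exact hlb.trans hfin

lemma core_all {r : ℕ} (hr : 1 ≤ r) : Core r := by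
  by_cases h : 25 ≤ r
  · exact core_large h
  push Not at h
  interval_cases r
  exacts [core_1, core_2, core_3, core_4, core_5, core_6, core_7, core_8, core_9, core_10, core_11, core_12,
    core_13, core_14, core_15, core_16, core_17, core_18, core_19, core_20, core_21, core_22, core_23, core_24]

theorem exponential_sum_approximation_of_inverse
    (β : ℝ) (hβ : 0 < β) (r : ℕ) (hr : 1 ≤ r) :
    ∃ ω a : Fin r → ℝ,
      (∀ k, 0 < ω k) ∧ (∀ k, 0 < a k) ∧
      (∀ x : ℝ, β ≤ x →
        |1 / x - ∑ k, ω k * Real.exp (-(a k) * x)|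
          ≤ (16 / β) * Real.exp (-Real.pi * Real.sqrt r)) ∧
      (∀ x : ℝ, (max β 1 / 8) * Real.exp (Real.pi * Real.sqrt r) ≤ x →
        ∑ k, ω k * Real.exp (-(a k) * x) ≤ 1 / x) := by
  obtain ⟨ω, a, hω, ha, h1, h2⟩ := core_all hr
  have key : ∀ x : ℝ, ∑ k, ω k / β * Real.exp (-(a k / β) * x) =
      (1 / β) * ∑ k, ω k * Real.exp (-(a k) * (x / β)) := by
    intro x
    rw [Finset.mul_sum]
    refine Finset.sum_congr rfl fun k _ => ?_
    have : -(a k / β) * x = -(a k) * (x / β) := by ring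
    rw [this]; ring
  refine ⟨fun k => ω k / β, fun k => a k / β, fun k => div_pos (hω k) hβ, fun k => div_pos (ha k) hβ, ?_, ?_⟩
  · intro x hx
    have x0 : 0 < x := hβ.trans_le hx
    have h := h1 (x / β) ((one_le_div hβ).2 hx)
    simp only [key]
    have e : 1 / x = (1 / β) * (1 / (x / β)) := by field_simp
    rw [e, ← mul_sub, abs_mul, abs_of_pos (by positivity : 0 < 1 / β)]
    have e2 : -Real.pi * Real.sqrt r = -(Real.pi * √(r : ℝ)) := by ring
    rw [e2]
    calc _ ≤ (1 / β) * (16 * Real.exp (-(Real.pi * √(r : ℝ)))) :=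
          mul_le_mul_of_nonneg_left h (by positivity)
      _ = _ := by ring
  · intro x hx
    have x0 : 0 < x := lt_of_lt_of_le (by positivity) hx
    simp only [key]
    have e : 1 / x = (1 / β) * (1 / (x / β)) := by field_simp
    rw [e]
    exact mul_le_mul_of_nonneg_left (h2 (x / β) (div_pos x0 hβ)) (by positivity)
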